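/- Let Σ be a complete connected translating graph in a direction v_θ = sin θ·e₃ + cos θ·e₂ (θ ∈ [0,π)), contained in the slab {(x,y,z) : |x| ≤ w}, w > 0. Then for every t ∈ ℝ, every nonempty connected component W of Σ ∩ {y ≥ t} is unbounded in the y-direction: sup{⟨p, e₂⟩ : p ∈ W} = +∞. -/

import Mathlib

open MeasureTheory Metric Real EuclideanSpace
open scoped RealInnerProductSpace ENNReal NNReal

noncomputable section

abbrev E3 : Type := EuclideanSpace ℝ (Fin 3)

def e1 : E3 := EuclideanSpace.single 0 1
def e2 : E3 := EuclideanSpace.single 1 1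
def e3 : E3 := EuclideanSpace.single 2 1

/-- First partial derivative of `u` in the first variable. -/
def pds (u : ℝ × ℝ → ℝ) (p : ℝ × ℝ) : ℝ := fderiv ℝ u p (1, 0)

/-- First partial derivative of `u` in the second variable. -/
def pdt (u : ℝ × ℝ → ℝ) (p : ℝ × ℝ) : ℝ := fderiv ℝ u p (0, 1)

/-- `S` is a translating graph in the direction of the unit vector `v`, with respect to the
orthonormal basis `(a, b, v)` of `ℝ³`, over the open connected domain `Ω ⊆ ℝ²`, given by the
smooth function `u : Ω → ℝ` solving the translator equation. -/
structure IsTranslatingGraph (a b v : E3) (Ω : Set (ℝ × ℝ)) (u : ℝ × ℝ → ℝ)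
    (S : Set E3) : Prop where
  norm_a : ‖a‖ = 1
  norm_b : ‖b‖ = 1
  norm_v : ‖v‖ = 1
  inner_ab : ⟪a, b⟫ = 0
  inner_av : ⟪a, v⟫ = 0
  inner_bv : ⟪b, v⟫ = 0
  isOpen_dom : IsOpen Ω
  isConnected_dom : IsConnected Ω
  smooth : ContDiffOn ℝ (⊤ : ℕ∞) u Ω
  pde : ∀ p ∈ Ω,
    (1 + (pdt u p) ^ 2) * pds (fun q => pds u q) p
      - 2 * pds u p * pdt u p * pdt (fun q => pds u q) p
      + (1 + (pds u p) ^ 2) * pdt (fun q => pdt u q) p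
    = (1 + (pds u p) ^ 2 + (pdt u p) ^ 2) *
        (⟪e3, v⟫ - pds u p * ⟪e3, a⟫ - pdt u p * ⟪e3, b⟫)
  graph_eq : S = {q : E3 | ∃ p ∈ Ω, q = p.1 • a + p.2 • b + u p • v}

/-- Entropy of a surface. -/
def entropy (S : Set E3) : ℝ≥0∞ :=
  ⨆ (x₀ : E3) (s₀ : ℝ) (_ : 0 < s₀),
    (ENNReal.ofReal (4 * π * s₀))⁻¹ *
      ∫⁻ q in S, ENNReal.ofReal (Real.exp (-‖q - x₀‖ ^ 2 / (4 * s₀))) ∂(μH[2])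

/-- Number of connected components (as a cardinal). -/
def numComponents (A : Set E3) : Cardinal := Cardinal.mk (ConnectedComponents A)

def vθ (θ : ℝ) : E3 := Real.sin θ • e3 + Real.cos θ • e2
def bθ (θ : ℝ) : E3 := Real.cos θ • e3 - Real.sin θ • e2


/-- The point of the translating graph over parameter `p`, for the basis `(e₁, b_θ, v_θ)`. -/
def graphPtθ (θ : ℝ) (u : ℝ × ℝ → ℝ) (p : ℝ × ℝ) : E3 :=
  p.1 • e1 + p.2 • bθ θ + u p • vθ θ

/-- The Gauss map of a translating graph in the direction `v_θ`, as a function of the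
parameter `p ∈ Ω`: `N = (v_θ − u_s e₁ − u_t b_θ)/√(1+u_s²+u_t²)`. -/
def gaussMapθ (θ : ℝ) (u : ℝ × ℝ → ℝ) (p : ℝ × ℝ) : E3 :=
  (Real.sqrt (1 + (pds u p) ^ 2 + (pdt u p) ^ 2))⁻¹ •
    (vθ θ - pds u p • e1 - pdt u p • bθ θ)

/-- The derivative of `f : ℂ → ℂ` in the direction `v`, over the reals. -/
def dirDeriv (v : ℂ) (f : ℂ → ℂ) (z : ℂ) : ℂ := fderiv ℝ f z v

/-- All partial derivatives of `f` of order less than `n` vanish at the origin. -/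
def JetZero : ℕ → (ℂ → ℂ) → Prop
  | 0, _ => True
  | n + 1, f => f 0 = 0 ∧ JetZero n (dirDeriv 1 f) ∧ JetZero n (dirDeriv Complex.I f)

theorem ContDiff.derivAlong {f : ℂ → ℂ} (hf : ContDiff ℝ (⊤ : ℕ∞) f) (v : ℂ) :
    ContDiff ℝ (⊤ : ℕ∞) (dirDeriv v f) :=
  (hf.fderiv_right (m := (⊤ : ℕ∞)) (by simp)).clm_apply contDiff_const

theorem dirDeriv_add {f g : ℂ → ℂ} (hf : ContDiff ℝ (⊤ : ℕ∞) f) (hg : ContDiff ℝ (⊤ : ℕ∞) g)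
    (v : ℂ) : dirDeriv v (f + g) = dirDeriv v f + dirDeriv v g := by
  funext z
  have h1 := hf.differentiable (by simp) z
  have h2 := hg.differentiable (by simp) z
  simp [dirDeriv, fderiv_add h1 h2]

theorem dirDeriv_mul {f g : ℂ → ℂ} (hf : ContDiff ℝ (⊤ : ℕ∞) f) (hg : ContDiff ℝ (⊤ : ℕ∞) g)
    (v : ℂ) : dirDeriv v (f * g) = f * dirDeriv v g + dirDeriv v f * g := by
  funext z
  have h1 := hf.differentiable (by simp) z
  have h2 := hg.differentiable (by simp) z
  simp [dirDeriv, fderiv_mul h1 h2, mul_comm]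

theorem dirDeriv_const (c v : ℂ) : dirDeriv v (fun _ => c) = 0 := by
  funext z
  simp [dirDeriv]

theorem dirDeriv_pow (n : ℕ) (v z : ℂ) :
    dirDeriv v (fun z => z ^ n) z = n * z ^ (n - 1) * v := by
  have h := ((hasDerivAt_pow n z).hasFDerivAt.restrictScalars ℝ).fderiv
  simp only [dirDeriv]
  rw [h]
  simp [mul_comm]

theorem dirDeriv_conj {f : ℂ → ℂ} (hf : ContDiff ℝ (⊤ : ℕ∞) f) (v : ℂ) :
    dirDeriv v (fun z => (starRingEnd ℂ) (f z)) = fun z => (starRingEnd ℂ) (dirDeriv v f z) := by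
  funext z
  have h1 := (hf.differentiable (by simp) z).hasFDerivAt
  have h2 := ((Complex.conjCLE : ℂ →L[ℝ] ℂ).hasFDerivAt.comp z h1).fderiv
  simp only [dirDeriv]
  change fderiv ℝ ((Complex.conjCLE : ℂ →L[ℝ] ℂ) ∘ f) z v = _
  rw [h2]
  simp

theorem dirDeriv_comm {f : ℂ → ℂ} (hf : ContDiff ℝ (⊤ : ℕ∞) f) (v w : ℂ) :
    dirDeriv v (dirDeriv w f) = dirDeriv w (dirDeriv v f) := by
  funext z
  have h1 : Differentiable ℝ (fderiv ℝ f) :=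
    (hf.fderiv_right (m := (⊤ : ℕ∞)) (by simp)).differentiable (by simp)
  have key : ∀ a b : ℂ, dirDeriv a (dirDeriv b f) z = fderiv ℝ (fderiv ℝ f) z a b := by
    intro a b
    have := ((h1 z).hasFDerivAt.clm_apply (hasFDerivAt_const b z)).fderiv
    simp only [dirDeriv]
    change fderiv ℝ (fun y => (fderiv ℝ f y) b) z a = _
    rw [this]
    simp
  rw [key, key]
  exact (hf.contDiffAt.isSymmSndFDerivAt (by simp; exact WithTop.coe_le_coe.2 (le_top : (2 : ℕ∞) ≤ ⊤))) v w

theorem fderiv_eq_dirDeriv (f : ℂ → ℂ) (z v : ℂ) :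
    fderiv ℝ f z v = v.re * dirDeriv 1 f z + v.im * dirDeriv Complex.I f z := by
  have : v = v.re • (1 : ℂ) + v.im • Complex.I := by simp
  conv_lhs => rw [this]
  rw [map_add, map_smul, map_smul]
  simp [dirDeriv]

namespace JetZero

theorem congr {n : ℕ} : ∀ {f g : ℂ → ℂ}, JetZero n f → f =ᶠ[nhds 0] g → JetZero n g := by
  induction n with
  | zero => intros; trivial
  | succ n ih =>
    rintro f g ⟨h0, h1, h2⟩ hfg
    have key : ∀ v, dirDeriv v f =ᶠ[nhds 0] dirDeriv v g := fun v =>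
      (hfg.fderiv (𝕜 := ℝ)).mono fun z hz => by simp only [dirDeriv, hz]
    exact ⟨hfg.eq_of_nhds ▸ h0, ih h1 (key 1), ih h2 (key _)⟩

theorem of_succ {n : ℕ} : ∀ {f : ℂ → ℂ}, JetZero (n + 1) f → JetZero n f := by
  induction n with
  | zero => intros; trivial
  | succ n ih =>
    rintro f ⟨h0, h1, h2⟩
    exact ⟨h0, ih h1, ih h2⟩

theorem add {n : ℕ} : ∀ {f g : ℂ → ℂ}, ContDiff ℝ (⊤ : ℕ∞) f → ContDiff ℝ (⊤ : ℕ∞) g →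
    JetZero n f → JetZero n g → JetZero n (f + g) := by
  induction n with
  | zero => intros; trivial
  | succ n ih =>
    rintro f g hf hg ⟨h0, h1, h2⟩ ⟨k0, k1, k2⟩
    refine ⟨by simp [h0, k0], ?_, ?_⟩
    · rw [dirDeriv_add hf hg]; exact ih (hf.derivAlong _) (hg.derivAlong _) h1 k1
    · rw [dirDeriv_add hf hg]; exact ih (hf.derivAlong _) (hg.derivAlong _) h2 k2

theorem mul {n : ℕ} : ∀ {b f : ℂ → ℂ}, ContDiff ℝ (⊤ : ℕ∞) b → ContDiff ℝ (⊤ : ℕ∞) f →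
    JetZero n f → JetZero n (b * f) := by
  induction n with
  | zero => intros; trivial
  | succ n ih =>
    rintro b f hb hf h
    have hn := h.of_succ
    obtain ⟨h0, h1, h2⟩ := h
    have key : ∀ v, JetZero n (dirDeriv v f) → JetZero n (dirDeriv v (b * f)) := fun v hv => by
      rw [dirDeriv_mul hb hf]
      exact add (hb.mul (hf.derivAlong v)) ((hb.derivAlong v).mul hf) (ih hb (hf.derivAlong v) hv)
        (ih (hb.derivAlong v) hf hn)
    exact ⟨by simp [h0], key _ h1, key _ h2⟩

theorem conj {n : ℕ} : ∀ {f : ℂ → ℂ}, ContDiff ℝ (⊤ : ℕ∞) f → JetZero n f →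
    JetZero n (fun z => (starRingEnd ℂ) (f z)) := by
  induction n with
  | zero => intros; trivial
  | succ n ih =>
    rintro f hf ⟨h0, h1, h2⟩
    refine ⟨by simp [h0], ?_, ?_⟩
    · rw [dirDeriv_conj hf]; exact ih (hf.derivAlong _) h1
    · rw [dirDeriv_conj hf]; exact ih (hf.derivAlong _) h2

theorem bound {n : ℕ} : ∀ {f : ℂ → ℂ}, ContDiff ℝ (⊤ : ℕ∞) f → JetZero n f →
    ∃ C, ∀ z, ‖z‖ ≤ 1 → ‖f z‖ ≤ C * ‖z‖ ^ n := by
  induction n with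
  | zero =>
    intro f hf _
    obtain ⟨C, hC⟩ := (isCompact_closedBall (0 : ℂ) 1).exists_bound_of_continuousOn
      hf.continuous.continuousOn
    exact ⟨C, fun z hz => by simpa using hC z (by simpa using hz)⟩
  | succ n ih =>
    rintro f hf ⟨h0, h1, h2⟩
    obtain ⟨C₁, hC₁⟩ := ih (hf.derivAlong _) h1
    obtain ⟨C₂, hC₂⟩ := ih (hf.derivAlong _) h2
    refine ⟨max C₁ 0 + max C₂ 0, fun z hz => ?_⟩
    have hd : ∀ x ∈ closedBall (0 : ℂ) ‖z‖,
        ‖fderiv ℝ f x‖ ≤ (max C₁ 0 + max C₂ 0) * ‖z‖ ^ n := by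
      intro x hx
      have hx' : ‖x‖ ≤ ‖z‖ := by simpa using hx
      have hx1 : ‖x‖ ≤ 1 := hx'.trans hz
      have e : ‖x‖ ^ n ≤ ‖z‖ ^ n := by gcongr
      have e0 : 0 ≤ ‖x‖ ^ n := by positivity
      have b₁ : ‖dirDeriv 1 f x‖ ≤ max C₁ 0 * ‖z‖ ^ n :=
        (hC₁ x hx1).trans (mul_le_mul (le_max_left _ _) e e0 (le_max_right _ _))
      have b₂ : ‖dirDeriv Complex.I f x‖ ≤ max C₂ 0 * ‖z‖ ^ n :=
        (hC₂ x hx1).trans (mul_le_mul (le_max_left _ _) e e0 (le_max_right _ _))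
      refine ContinuousLinearMap.opNorm_le_bound _ (by positivity) fun v => ?_
      rw [fderiv_eq_dirDeriv]
      have hre : ‖(v.re : ℂ)‖ ≤ ‖v‖ := by simpa using Complex.abs_re_le_norm v
      have him : ‖(v.im : ℂ)‖ ≤ ‖v‖ := by simpa using Complex.abs_im_le_norm v
      calc _ ≤ ‖(v.re : ℂ)‖ * ‖dirDeriv 1 f x‖ + ‖(v.im : ℂ)‖ * ‖dirDeriv Complex.I f x‖ := by
            refine (norm_add_le _ _).trans (by simp)
        _ ≤ ‖v‖ * (max C₁ 0 * ‖z‖ ^ n) + ‖v‖ * (max C₂ 0 * ‖z‖ ^ n) := by gcongr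
        _ = _ := by ring
    have := (convex_closedBall (0 : ℂ) ‖z‖).norm_image_sub_le_of_norm_fderiv_le
      (fun x _ => hf.differentiable (by simp) x) hd
      (by simp : (0 : ℂ) ∈ closedBall 0 ‖z‖) (by simp : z ∈ closedBall 0 ‖z‖)
    rw [h0] at this
    simpa [pow_succ, mul_assoc] using this

/-- If `f` and `∂̄ f` both vanish to order `n` at the origin then `f` agrees with a multiple of
`z ^ n` to order `n + 1`. -/
theorem exists_leading_coeff {n : ℕ} : ∀ {f : ℂ → ℂ}, ContDiff ℝ (⊤ : ℕ∞) f → JetZero n f →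
    JetZero n (fun z => dirDeriv Complex.I f z + -Complex.I * dirDeriv 1 f z) →
    ∃ c : ℂ, JetZero (n + 1) (fun z => f z + -c * z ^ n) := by
  induction n with
  | zero =>
    intro f hf _ _
    exact ⟨f 0, by simp, trivial, trivial⟩
  | succ n ih =>
    rintro f hf ⟨h0, h1, h2⟩ hE
    have c1 := hf.derivAlong 1
    have cI := hf.derivAlong Complex.I
    have cE : ContDiff ℝ (⊤ : ℕ∞) (fun _ : ℂ => -Complex.I) := contDiff_const
    have hE1 : JetZero n (fun z => dirDeriv Complex.I (dirDeriv 1 f) z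
        + -Complex.I * dirDeriv 1 (dirDeriv 1 f) z) := by
      have := hE.2.1
      have e : (fun z => dirDeriv Complex.I f z + -Complex.I * dirDeriv 1 f z)
        = dirDeriv Complex.I f + (fun _ => -Complex.I) * dirDeriv 1 f := rfl
      have c2 : ContDiff ℝ (⊤ : ℕ∞) ((fun _ => -Complex.I) * dirDeriv 1 f) := cE.mul c1
      rw [e, dirDeriv_add cI c2, dirDeriv_mul cE c1, dirDeriv_const, dirDeriv_comm hf] at this
      simpa [Pi.add_def, Pi.mul_def] using this
    obtain ⟨c, hc⟩ := ih c1 h1 hE1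
    refine ⟨c / (n + 1), ?_⟩
    have hn : (n + 1 : ℂ) ≠ 0 := by exact_mod_cast Nat.succ_ne_zero n
    have cp : ContDiff ℝ (⊤ : ℕ∞) (fun z : ℂ => z ^ (n + 1)) := contDiff_id.pow _
    have cc : ContDiff ℝ (⊤ : ℕ∞) (fun _ : ℂ => -(c / (n + 1))) := contDiff_const
    have key : ∀ v, dirDeriv v (fun z => f z + -(c / (n + 1)) * z ^ (n + 1)) =
        fun z => dirDeriv v f z + -c * z ^ n * v := by
      intro v
      have e : (fun z => f z + -(c / (n + 1)) * z ^ (n + 1))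
        = f + (fun _ => -(c / (n + 1))) * (fun z => z ^ (n + 1)) := rfl
      have c2 : ContDiff ℝ (⊤ : ℕ∞) ((fun _ => -(c / (n + 1))) * fun z : ℂ => z ^ (n + 1)) :=
        cc.mul cp
      rw [e, dirDeriv_add hf c2, dirDeriv_mul cc cp, dirDeriv_const]
      funext z
      simp only [Pi.add_apply, Pi.mul_apply, dirDeriv_pow]
      push_cast
      field_simp
      simp
    refine ⟨by simp [h0], ?_, ?_⟩
    · rw [key]; simpa using hc
    · rw [key]
      have cI' : ContDiff ℝ (⊤ : ℕ∞) (fun _ : ℂ => Complex.I) := contDiff_const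
      have cg : ContDiff ℝ (⊤ : ℕ∞) (fun z => dirDeriv 1 f z + -c * z ^ n) :=
        c1.add (contDiff_const.mul (contDiff_id.pow _))
      have := add (cI.add (cE.mul c1)) (cI'.mul cg) hE (mul cI' cg hc)
      refine this.congr (Filter.Eventually.of_forall fun z => ?_)
      simp only [Pi.add_apply]
      ring

end JetZero

theorem integral_fderiv_mul_fderiv_comm {P Q : ℂ → ℝ} (hP : ContDiff ℝ 2 P) (hQ : ContDiff ℝ 2 Q)
    (cP : HasCompactSupport P) (v w : ℂ) :
    ∫ z, fderiv ℝ P z v * fderiv ℝ Q z w = ∫ z, fderiv ℝ P z w * fderiv ℝ Q z v := by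
  have hdP : ∀ a, Continuous fun z => fderiv ℝ P z a := fun a =>
    (hP.continuous_fderiv (by simp)).clm_apply continuous_const
  have hdQ : ∀ a, ContDiff ℝ 1 fun z => fderiv ℝ Q z a := fun a =>
    (hQ.fderiv_right (m := 1) (by norm_num)).clm_apply contDiff_const
  have cdP : ∀ a, HasCompactSupport fun z => fderiv ℝ P z a := fun a => cP.fderiv_apply ℝ a
  have key : ∀ a b, ∫ z, P z * fderiv ℝ (fun y => fderiv ℝ Q y b) z a
      = - ∫ z, fderiv ℝ P z a * fderiv ℝ Q z b := fun a b =>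
    integral_mul_fderiv_eq_neg_fderiv_mul_of_integrable
      (((hdP a).mul (hdQ b).continuous).integrable_of_hasCompactSupport (cdP a).mul_right)
      ((hP.continuous.mul (((hdQ b).continuous_fderiv (by simp)).clm_apply
        continuous_const)).integrable_of_hasCompactSupport cP.mul_right)
      ((hP.continuous.mul (hdQ b).continuous).integrable_of_hasCompactSupport cP.mul_right)
      (fun x _ => hP.differentiable (by simp) x) (fun x _ => (hdQ b).differentiable (by simp) x)
  have symm : ∀ z, fderiv ℝ (fun y => fderiv ℝ Q y w) z v = fderiv ℝ (fun y => fderiv ℝ Q y v) z w := by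
    intro z
    have h1 : Differentiable ℝ (fderiv ℝ Q) :=
      (hQ.fderiv_right (m := 1) (by norm_num)).differentiable (by simp)
    have k : ∀ a b : ℂ, fderiv ℝ (fun y => fderiv ℝ Q y b) z a = fderiv ℝ (fderiv ℝ Q) z a b := by
      intro a b
      rw [((h1 z).hasFDerivAt.clm_apply (hasFDerivAt_const b z)).fderiv]
      simp
    rw [k, k]
    exact (hQ.contDiffAt.isSymmSndFDerivAt (by simp)) v w
  have e1 := key v w
  have e2 := key w v
  simp only [symm] at e1
  linarith

theorem integral_sq_add_re_mul_fderiv {P : ℂ → ℝ} (hP : ContDiff ℝ 2 P)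
    (cP : HasCompactSupport P) :
    ∫ z, (P z ^ 2 + 2 * z.re * P z * fderiv ℝ P z 1) = 0 := by
  have hdP : Continuous fun z => fderiv ℝ P z 1 :=
    (hP.continuous_fderiv (by simp)).clm_apply continuous_const
  have hre : ∀ z : ℂ, fderiv ℝ Complex.re z 1 = 1 := fun z => by
    change fderiv ℝ (⇑Complex.reCLM) z 1 = 1
    simp
  have hsq : ∀ z : ℂ, fderiv ℝ (fun y => P y ^ 2) z 1 = 2 * P z * fderiv ℝ P z 1 := fun z => by
    rw [((hP.differentiable (by simp) z).hasFDerivAt.pow 2).fderiv]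
    simp
  have cP2 : HasCompactSupport fun z => P z ^ 2 := cP.comp_left (g := fun x : ℝ => x ^ 2) (by simp)
  have i1 : Integrable fun z => P z ^ 2 :=
    (hP.continuous.pow 2).integrable_of_hasCompactSupport cP2
  have i2 : Integrable fun z : ℂ => z.re * (2 * P z * fderiv ℝ P z 1) :=
    (by fun_prop : Continuous fun z : ℂ => z.re * (2 * P z * fderiv ℝ P z 1)
      ).integrable_of_hasCompactSupport ((cP.mul_left.mul_right).mul_left)
  have i3 : Integrable fun z : ℂ => z.re * P z ^ 2 :=
    (Complex.continuous_re.mul (hP.continuous.pow 2)).integrable_of_hasCompactSupport cP2.mul_left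
  have := integral_mul_fderiv_eq_neg_fderiv_mul_of_integrable (μ := (volume : Measure ℂ))
    (f := Complex.re) (g := fun z => P z ^ 2) (v := 1) (by simpa only [hre, one_mul] using i1)
    (by simpa only [hsq] using i2) i3 (fun x _ => Complex.reCLM.differentiableAt)
    (fun x _ => (hP.differentiable (by simp) x).pow 2)
  simp only [hre, hsq, one_mul] at this
  rw [show (fun z : ℂ => P z ^ 2 + 2 * z.re * P z * fderiv ℝ P z 1)
    = fun z => P z ^ 2 + z.re * (2 * P z * fderiv ℝ P z 1) from by funext z; ring,
    integral_add i1 i2, this]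
  ring

theorem dbar_pointwise_le {p q x a b c d R : ℝ} (h : x ^ 2 ≤ R ^ 2 ∨ p = 0 ∧ q = 0) :
    p * p + q * q - 4 * R ^ 2 * ((a - d) * (a - d) + (c + b) * (c + b)) ≤
      2 * (p ^ 2 + 2 * x * p * a) + 2 * (q ^ 2 + 2 * x * q * c)
        - 8 * R ^ 2 * (b * c - a * d) := by
  have hb := mul_nonneg (sq_nonneg R) (sq_nonneg b)
  have hd := mul_nonneg (sq_nonneg R) (sq_nonneg d)
  rcases h with h | ⟨rfl, rfl⟩
  · linarith [sq_nonneg (p + 2 * x * a), sq_nonneg (q + 2 * x * c),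
      mul_nonneg (sub_nonneg.2 h) (sq_nonneg a), mul_nonneg (sub_nonneg.2 h) (sq_nonneg c)]
  · linarith [mul_nonneg (sq_nonneg R) (sq_nonneg a), mul_nonneg (sq_nonneg R) (sq_nonneg c)]

/-- A Poincaré inequality for the operator `∂̄` on compactly supported functions. -/
theorem integral_norm_sq_le_dbar {F : ℂ → ℂ} (hF : ContDiff ℝ 2 F) {R : ℝ}
    (hR : ∀ z, F z ≠ 0 → ‖z‖ ≤ R) :
    ∫ z, ‖F z‖ ^ 2 ≤
      4 * R ^ 2 * ∫ z, ‖dirDeriv 1 F z + Complex.I * dirDeriv Complex.I F z‖ ^ 2 := by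
  have cF : HasCompactSupport F := by
    refine HasCompactSupport.of_support_subset_isCompact (isCompact_closedBall (0 : ℂ) R) ?_
    intro z hz
    simpa using hR z hz
  set P : ℂ → ℝ := fun z => (F z).re with hPdef
  set Q : ℂ → ℝ := fun z => (F z).im with hQdef
  have hP : ContDiff ℝ 2 P := Complex.reCLM.contDiff.comp hF
  have hQ : ContDiff ℝ 2 Q := Complex.imCLM.contDiff.comp hF
  have cP : HasCompactSupport P := cF.comp_left (g := Complex.re) (by simp)
  have cQ : HasCompactSupport Q := cF.comp_left (g := Complex.im) (by simp)
  have hFP : ∀ z v, (dirDeriv v F z).re = fderiv ℝ P z v := fun z v => by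
    have := (Complex.reCLM.hasFDerivAt.comp z (hF.differentiable (by simp) z).hasFDerivAt).fderiv
    change _ = fderiv ℝ (⇑Complex.reCLM ∘ F) z v
    rw [this]; rfl
  have hFQ : ∀ z v, (dirDeriv v F z).im = fderiv ℝ Q z v := fun z v => by
    have := (Complex.imCLM.hasFDerivAt.comp z (hF.differentiable (by simp) z).hasFDerivAt).fderiv
    change _ = fderiv ℝ (⇑Complex.imCLM ∘ F) z v
    rw [this]; rfl
  have hdP : ∀ a, Continuous fun z => fderiv ℝ P z a := fun a =>
    (hP.continuous_fderiv (by simp)).clm_apply continuous_const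
  have hdQ : ∀ a, Continuous fun z => fderiv ℝ Q z a := fun a =>
    (hQ.continuous_fderiv (by simp)).clm_apply continuous_const
  have cdP : ∀ a, HasCompactSupport fun z => fderiv ℝ P z a := fun a => cP.fderiv_apply ℝ a
  have cdF : ∀ a, HasCompactSupport (dirDeriv a F) := fun a => cF.fderiv_apply ℝ a
  have hdF : ∀ a, Continuous (dirDeriv a F) := fun a =>
    (hF.continuous_fderiv (by simp)).clm_apply continuous_const
  have hF0 := hF.continuous
  have i0 : Integrable fun z => ‖F z‖ ^ 2 := by
    have k1 : Continuous fun z => ‖F z‖ ^ 2 := by fun_prop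
    have k2 : HasCompactSupport fun z => ‖F z‖ ^ 2 :=
      cF.comp_left (g := fun x : ℂ => ‖x‖ ^ 2) (by simp)
    exact k1.integrable_of_hasCompactSupport k2
  have i1 : Integrable fun z => ‖dirDeriv 1 F z + Complex.I * dirDeriv Complex.I F z‖ ^ 2 := by
    have h1 := hdF 1
    have hI := hdF Complex.I
    have k1 : Continuous fun z =>
      ‖dirDeriv 1 F z + Complex.I * dirDeriv Complex.I F z‖ ^ 2 := by fun_prop
    have k0 : HasCompactSupport fun z => Complex.I * dirDeriv Complex.I F z :=
      (cdF Complex.I).comp_left (g := fun x : ℂ => Complex.I * x) (by simp)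
    have k3 : HasCompactSupport fun z => dirDeriv 1 F z + Complex.I * dirDeriv Complex.I F z :=
      (cdF 1).add k0
    have k2 : HasCompactSupport fun z =>
        ‖dirDeriv 1 F z + Complex.I * dirDeriv Complex.I F z‖ ^ 2 :=
      k3.comp_left (g := fun x : ℂ => ‖x‖ ^ 2) (by simp)
    exact k1.integrable_of_hasCompactSupport k2
  have i2 : ∀ {S : ℂ → ℝ}, ContDiff ℝ 2 S → HasCompactSupport S →
      Integrable fun z : ℂ => S z ^ 2 + 2 * z.re * S z * fderiv ℝ S z 1 := by
    intro S hS cS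
    have h1 : Continuous fun z => fderiv ℝ S z 1 :=
      (hS.continuous_fderiv (by simp)).clm_apply continuous_const
    have h0 := hS.continuous
    have k1 : Continuous fun z : ℂ => S z ^ 2 + 2 * z.re * S z * fderiv ℝ S z 1 := by
      have := Complex.continuous_re
      fun_prop
    have k2 : HasCompactSupport fun z : ℂ => S z ^ 2 :=
      cS.comp_left (g := fun x : ℝ => x ^ 2) (by simp)
    have k3 : HasCompactSupport fun z : ℂ => 2 * z.re * S z * fderiv ℝ S z 1 :=
      (cS.mul_left (f := fun z : ℂ => 2 * z.re)).mul_right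
    have k4 : HasCompactSupport fun z : ℂ => S z ^ 2 + 2 * z.re * S z * fderiv ℝ S z 1 :=
      k2.add k3
    exact k1.integrable_of_hasCompactSupport k4
  have i3 : ∀ a b, Integrable fun z => fderiv ℝ P z a * fderiv ℝ Q z b := fun a b =>
    ((hdP a).mul (hdQ b)).integrable_of_hasCompactSupport (cdP a).mul_right
  have j1 : Integrable fun z : ℂ => 2 * (P z ^ 2 + 2 * z.re * P z * fderiv ℝ P z 1) :=
    (i2 hP cP).const_mul 2
  have j2 : Integrable fun z : ℂ => 2 * (Q z ^ 2 + 2 * z.re * Q z * fderiv ℝ Q z 1) :=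
    (i2 hQ cQ).const_mul 2
  have j3 : Integrable fun z : ℂ => 2 * (P z ^ 2 + 2 * z.re * P z * fderiv ℝ P z 1)
      + 2 * (Q z ^ 2 + 2 * z.re * Q z * fderiv ℝ Q z 1) := j1.add j2
  have j4 : Integrable fun z : ℂ => 8 * R ^ 2 * (fderiv ℝ P z Complex.I * fderiv ℝ Q z 1
        - fderiv ℝ P z 1 * fderiv ℝ Q z Complex.I) := ((i3 _ _).sub (i3 _ _)).const_mul _
  have hint : ∫ z : ℂ, (2 * (P z ^ 2 + 2 * z.re * P z * fderiv ℝ P z 1)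
      + 2 * (Q z ^ 2 + 2 * z.re * Q z * fderiv ℝ Q z 1)
      - 8 * R ^ 2 * (fderiv ℝ P z Complex.I * fderiv ℝ Q z 1
        - fderiv ℝ P z 1 * fderiv ℝ Q z Complex.I)) = 0 := by
    rw [integral_sub j3 j4, integral_add j1 j2, integral_const_mul, integral_const_mul,
      integral_const_mul,
      integral_sub (i3 _ _) (i3 _ _), integral_sq_add_re_mul_fderiv hP cP,
      integral_sq_add_re_mul_fderiv hQ cQ, integral_fderiv_mul_fderiv_comm hP hQ cP]
    ring
  have hle : ∫ z, (‖F z‖ ^ 2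
      - 4 * R ^ 2 * ‖dirDeriv 1 F z + Complex.I * dirDeriv Complex.I F z‖ ^ 2) ≤ 0 := by
    rw [← hint]
    refine integral_mono (i0.sub (i1.const_mul _)) (j3.sub j4) fun z => ?_
    simp only [Complex.sq_norm, Complex.normSq_apply, Complex.add_re, Complex.add_im,
      Complex.mul_re, Complex.mul_im, Complex.I_re, Complex.I_im, hFP, hFQ]
    refine le_of_eq_of_le ?_ (dbar_pointwise_le (R := R) (p := P z) (q := Q z) (x := z.re)
      (a := fderiv ℝ P z 1) (b := fderiv ℝ P z Complex.I) (c := fderiv ℝ Q z 1)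
      (d := fderiv ℝ Q z Complex.I) ?_)
    · simp only [P, Q]
      ring
    · by_cases hz : F z = 0
      · exact Or.inr ⟨by simp [hPdef, hz], by simp [hQdef, hz]⟩
      · exact Or.inl (sq_le_sq' (by linarith [hR z hz, (abs_le.1 (Complex.abs_re_le_norm z)).1])
          (by linarith [hR z hz, (abs_le.1 (Complex.abs_re_le_norm z)).2]))
  rw [integral_sub i0 (i1.const_mul _), integral_const_mul] at hle
  linarith

/-- `f` is smooth and vanishes to infinite order at the origin. -/
def FlatAtZero (f : ℂ → ℂ) : Prop := ContDiff ℝ (⊤ : ℕ∞) f ∧ ∀ n, JetZero n f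

namespace FlatAtZero

theorem derivAlong {f : ℂ → ℂ} (hf : FlatAtZero f) (v : ℂ) : FlatAtZero (dirDeriv v f) := by
  refine ⟨hf.1.derivAlong v, fun n => ?_⟩
  obtain ⟨-, h1, h2⟩ := hf.2 (n + 1)
  have c1 : ContDiff ℝ (⊤ : ℕ∞) fun _ : ℂ => (v.re : ℂ) := contDiff_const
  have c2 : ContDiff ℝ (⊤ : ℕ∞) fun _ : ℂ => (v.im : ℂ) := contDiff_const
  have := JetZero.add (c1.mul (hf.1.derivAlong 1)) (c2.mul (hf.1.derivAlong Complex.I))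
    (JetZero.mul c1 (hf.1.derivAlong 1) h1) (JetZero.mul c2 (hf.1.derivAlong Complex.I) h2)
  exact this.congr (Filter.Eventually.of_forall fun z => (fderiv_eq_dirDeriv f z v).symm)

theorem mul {b f : ℂ → ℂ} (hb : ContDiff ℝ (⊤ : ℕ∞) b) (hf : FlatAtZero f) :
    FlatAtZero (fun z => b z * f z) :=
  ⟨hb.mul hf.1, fun n => JetZero.mul hb hf.1 (hf.2 n)⟩

theorem add {f g : ℂ → ℂ} (hf : FlatAtZero f) (hg : FlatAtZero g) :
    FlatAtZero (fun z => f z + g z) :=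
  ⟨hf.1.add hg.1, fun n => JetZero.add hf.1 hg.1 (hf.2 n) (hg.2 n)⟩

theorem hasFDerivAt_div_pow {f : ℂ → ℂ} (hf : FlatAtZero f) (m : ℕ) :
    HasFDerivAt (fun z => f z / z ^ m) (0 : ℂ →L[ℝ] ℂ) 0 := by
  obtain ⟨C, hC⟩ := JetZero.bound hf.1 (hf.2 (m + 2))
  have h0 : f 0 = 0 := (hf.2 1).1
  rw [hasFDerivAt_iff_isLittleO_nhds_zero]
  refine Asymptotics.IsBigO.trans_isLittleO (g := fun h : ℂ => ‖h‖ ^ 2) ?_ ?_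
  · refine Asymptotics.IsBigO.of_bound C ?_
    filter_upwards [closedBall_mem_nhds (0 : ℂ) one_pos] with h hh
    simp only [zero_add, h0, zero_div, sub_zero, zero_apply, norm_div, norm_pow,
      norm_norm]
    by_cases hz : h = 0
    · simp [hz, h0]
    · rw [div_le_iff₀ (by positivity)]
      refine (hC h (by simpa using hh)).trans (le_of_eq (by ring))
  · exact Asymptotics.isLittleO_norm_right.1
      ((Asymptotics.isLittleO_pow_id one_lt_two).comp_tendsto tendsto_norm_zero)

theorem dirDeriv_div_pow {f : ℂ → ℂ} (hf : FlatAtZero f) (m : ℕ) (v z : ℂ) :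
    dirDeriv v (fun z => f z / z ^ m) z =
      (z * dirDeriv v f z + -(m * v) * f z) / z ^ (m + 1) := by
  by_cases hz : z = 0
  · subst hz
    simp [dirDeriv, (hf.hasFDerivAt_div_pow m).fderiv]
  · have h1 := (hf.1.differentiable (by simp) z).hasFDerivAt
    have h2 := ((hasDerivAt_pow m z).inv (pow_ne_zero m hz)).hasFDerivAt.restrictScalars ℝ
    have h3 := (h1.mul h2).fderiv
    simp only [dirDeriv, div_eq_mul_inv]
    change fderiv ℝ (f * (fun z => z ^ m)⁻¹) z v = _
    rw [h3]
    simp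
    rcases m with _ | m
    · simp; field_simp
    · field_simp
      simp
      field_simp
      ring

theorem differentiable_div_pow {f : ℂ → ℂ} (hf : FlatAtZero f) (m : ℕ) :
    Differentiable ℝ (fun z => f z / z ^ m) := by
  intro z
  by_cases hz : z = 0
  · subst hz
    exact (hf.hasFDerivAt_div_pow m).differentiableAt
  · have h2 := ((hasDerivAt_pow m z).inv (pow_ne_zero m hz)).hasFDerivAt.restrictScalars ℝ
    simp only [div_eq_mul_inv]
    exact (hf.1.differentiable (by simp) z).mul h2.differentiableAt

theorem contDiff_div_pow (k : ℕ) : ∀ {f : ℂ → ℂ} (_ : FlatAtZero f) (m : ℕ),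
    ContDiff ℝ k (fun z => f z / z ^ m) := by
  induction k with
  | zero => exact fun hf m => contDiff_zero.2 (hf.differentiable_div_pow m).continuous
  | succ k ih =>
    intro f hf m
    push_cast
    rw [contDiff_succ_iff_fderiv_apply]
    refine ⟨hf.differentiable_div_pow m, by simp, fun v => ?_⟩
    have e : (fun z => fderiv ℝ (fun z => f z / z ^ m) z v) =
        fun z => (z * dirDeriv v f z + -(m * v) * f z) / z ^ (m + 1) :=
      funext fun z => hf.dirDeriv_div_pow m v z
    rw [e]
    exact ih (add (mul contDiff_id (hf.derivAlong v)) (mul contDiff_const hf)) (m + 1)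

end FlatAtZero

/-- Twice the Cauchy–Riemann operator `∂̄`. -/
def dbar (f : ℂ → ℂ) (z : ℂ) : ℂ := dirDeriv 1 f z + Complex.I * dirDeriv Complex.I f z

theorem FlatAtZero.dbar_div_pow {f : ℂ → ℂ} (hf : FlatAtZero f) (m : ℕ) (z : ℂ) :
    dbar (fun z => f z / z ^ m) z = z * dbar f z / z ^ (m + 1) := by
  simp only [dbar, hf.dirDeriv_div_pow]
  rw [mul_div_assoc', ← add_div]
  congr 1
  linear_combination (-(m : ℂ) * f z) * Complex.I_mul_I

theorem ContDiff.continuous_dbar {f : ℂ → ℂ} (hf : ContDiff ℝ 1 f) : Continuous (dbar f) := by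
  have h : ∀ v, Continuous (dirDeriv v f) := fun v =>
    (hf.continuous_fderiv (by simp)).clm_apply continuous_const
  exact (h 1).add (continuous_const.mul (h _))

theorem dbar_mul {f g : ℂ → ℂ} (hf : Differentiable ℝ f) (hg : Differentiable ℝ g) (z : ℂ) :
    dbar (fun z => f z * g z) z = f z * dbar g z + dbar f z * g z := by
  have : ∀ v, dirDeriv v (fun z => f z * g z) z = f z * dirDeriv v g z + dirDeriv v f z * g z := by
    intro v
    change fderiv ℝ (f * g) z v = _
    rw [((hf z).hasFDerivAt.mul (hg z).hasFDerivAt).fderiv]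
    simp [dirDeriv, mul_comm]
  simp only [dbar, this]
  ring

/-- Weighted `L²` bound for a function that is flat at the origin and satisfies
`|∂̄ w| ≤ C |w|` nearby. -/
theorem FlatAtZero.integral_div_pow_le {w X : ℂ → ℂ} (hw : FlatAtZero w) {C R : ℝ} (hR : 0 < R)
    (hCR : 16 * R ^ 2 * C ^ 2 ≤ 1) (hC : ∀ z, ‖z‖ ≤ R → ‖dbar w z‖ ≤ C * ‖w z‖)
    (hX : ContDiff ℝ (⊤ : ℕ∞) X) (hXR : ∀ z, X z ≠ 0 → ‖z‖ ≤ R)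
    (hX1 : ∀ z, ‖z‖ < R / 2 → dbar X z = 0) (n : ℕ) :
    ∫ z, ‖X z * (w z / z ^ n)‖ ^ 2 ≤
      16 * R ^ 2 * ((2 / R) ^ (2 * n) * ∫ z, ‖dbar X z * w z‖ ^ 2) := by
  set F : ℂ → ℂ := fun z => X z * (w z / z ^ n) with hFdef
  have hX2 : ContDiff ℝ 2 X := hX.of_le (WithTop.coe_le_coe.2 (le_top : (2 : ℕ∞) ≤ ⊤))
  have hv : ContDiff ℝ 2 fun z => w z / z ^ n := hw.contDiff_div_pow 2 n
  have hF : ContDiff ℝ 2 F := hX2.mul hv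
  have hF1 : ContDiff ℝ 1 F := hF.of_le (by norm_num)
  have hFR : ∀ z, F z ≠ 0 → ‖z‖ ≤ R := fun z hz => hXR z (left_ne_zero_of_mul hz)
  have hF0 := hF.continuous
  have hFd := hF1.continuous_dbar
  have hXd := (hX2.of_le (by norm_num) : ContDiff ℝ 1 X).continuous_dbar
  have hw0 := hw.1.continuous
  have cX : HasCompactSupport X := by
    refine HasCompactSupport.of_support_subset_isCompact (isCompact_closedBall (0 : ℂ) R) ?_
    intro z hz
    simpa using hXR z hz
  have cdX : HasCompactSupport (dbar X) := by
    have k0 : HasCompactSupport fun z => Complex.I * dirDeriv Complex.I X z :=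
      HasCompactSupport.comp_left (f := dirDeriv Complex.I X) (cX.fderiv_apply ℝ Complex.I)
        (g := fun x : ℂ => Complex.I * x) (by simp)
    have k1 : HasCompactSupport (dirDeriv 1 X) := cX.fderiv_apply ℝ 1
    exact k1.add k0
  have cF : HasCompactSupport F := cX.mul_right
  have i0 : Integrable fun z => ‖F z‖ ^ 2 := by
    have k1 : Continuous fun z => ‖F z‖ ^ 2 := by fun_prop
    have k2 : HasCompactSupport fun z => ‖F z‖ ^ 2 :=
      cF.comp_left (g := fun x : ℂ => ‖x‖ ^ 2) (by simp)
    exact k1.integrable_of_hasCompactSupport k2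
  have i1 : Integrable fun z => ‖dbar X z * w z‖ ^ 2 := by
    have k1 : Continuous fun z => ‖dbar X z * w z‖ ^ 2 := by fun_prop
    have k3 : HasCompactSupport fun z => dbar X z * w z := cdX.mul_right
    have k2 : HasCompactSupport fun z => ‖dbar X z * w z‖ ^ 2 :=
      k3.comp_left (g := fun x : ℂ => ‖x‖ ^ 2) (by simp)
    exact k1.integrable_of_hasCompactSupport k2
  have hpt : ∀ z, ‖dbar F z‖ ^ 2 ≤
      2 * C ^ 2 * ‖F z‖ ^ 2 + 2 * (2 / R) ^ (2 * n) * ‖dbar X z * w z‖ ^ 2 := by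
    intro z
    have e : dbar F z = X z * (z * dbar w z / z ^ (n + 1)) + dbar X z * (w z / z ^ n) := by
      rw [hFdef, dbar_mul (hX2.differentiable (by simp)) (hv.differentiable (by simp)),
        hw.dbar_div_pow]
    have b1 : ‖X z * (z * dbar w z / z ^ (n + 1))‖ ^ 2 ≤ C ^ 2 * ‖F z‖ ^ 2 := by
      rw [← mul_pow]
      by_cases hx : X z = 0
      · simp [hx]; positivity
      by_cases hz : z = 0
      · subst hz; simp; positivity
      have : ‖X z * (z * dbar w z / z ^ (n + 1))‖ ≤ C * ‖F z‖ := by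
        have e : z * dbar w z / z ^ (n + 1) = dbar w z / z ^ n := by
          rw [pow_succ']; field_simp
        rw [e, hFdef]
        simp only [norm_mul, norm_div]
        have := hC z (hXR z hx)
        calc _ ≤ ‖X z‖ * (C * ‖w z‖ / ‖z ^ n‖) := by gcongr
          _ = _ := by ring
      gcongr
    have b2 : ‖dbar X z * (w z / z ^ n)‖ ^ 2 ≤ (2 / R) ^ (2 * n) * ‖dbar X z * w z‖ ^ 2 := by
      by_cases hx : dbar X z = 0
      · simp [hx]
      have hz : R / 2 ≤ ‖z‖ := not_lt.1 fun h => hx (hX1 z h)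
      have hz0 : 0 < ‖z‖ := by linarith
      rw [pow_mul' , ← mul_pow]
      have : ‖dbar X z * (w z / z ^ n)‖ ≤ (2 / R) ^ n * ‖dbar X z * w z‖ := by
        simp only [norm_mul, norm_div, norm_pow]
        have h1 : 1 / ‖z‖ ≤ 2 / R := by
          rw [div_le_div_iff₀ hz0 hR]; linarith
        calc _ = (1 / ‖z‖) ^ n * (‖dbar X z‖ * ‖w z‖) := by rw [one_div, inv_pow]; ring
          _ ≤ _ := by gcongr
      gcongr
    rw [e]
    have := norm_add_le (X z * (z * dbar w z / z ^ (n + 1))) (dbar X z * (w z / z ^ n))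
    calc _ ≤ (‖X z * (z * dbar w z / z ^ (n + 1))‖ + ‖dbar X z * (w z / z ^ n)‖) ^ 2 := by gcongr
      _ ≤ 2 * ‖X z * (z * dbar w z / z ^ (n + 1))‖ ^ 2 + 2 * ‖dbar X z * (w z / z ^ n)‖ ^ 2 := by
        linarith [add_pow_le (norm_nonneg (X z * (z * dbar w z / z ^ (n + 1))))
          (norm_nonneg (dbar X z * (w z / z ^ n))) 2]
      _ ≤ _ := by linarith
  have h1 := integral_norm_sq_le_dbar hF hFR
  have h2 : ∫ z, ‖dbar F z‖ ^ 2 ≤ 2 * C ^ 2 * (∫ z, ‖F z‖ ^ 2) +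
      2 * (2 / R) ^ (2 * n) * ∫ z, ‖dbar X z * w z‖ ^ 2 := by
    rw [← integral_const_mul, ← integral_const_mul,
      ← integral_add (i0.const_mul _) (i1.const_mul _)]
    exact integral_mono_of_nonneg (Filter.Eventually.of_forall fun z => by positivity)
      ((i0.const_mul _).add (i1.const_mul _)) (Filter.Eventually.of_forall hpt)
  have h3 : 0 ≤ ∫ z, ‖F z‖ ^ 2 := integral_nonneg fun z => by positivity
  change ∫ z, ‖F z‖ ^ 2 ≤ 4 * R ^ 2 * ∫ z, ‖dbar F z‖ ^ 2 at h1
  nlinarith [mul_le_mul_of_nonneg_left h2 (by positivity : 0 ≤ 4 * R ^ 2),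
    mul_le_mul_of_nonneg_right hCR h3]

/-- Strong unique continuation for `|∂̄ w| ≤ C |w|`. -/
theorem FlatAtZero.eventually_eq_zero {w : ℂ → ℂ} (hw : FlatAtZero w) {C R₀ : ℝ} (hR₀ : 0 < R₀)
    (hC : ∀ z, ‖z‖ ≤ R₀ → ‖dbar w z‖ ≤ C * ‖w z‖) : ∀ᶠ z in nhds 0, w z = 0 := by
  obtain ⟨R, hR, hRR, hCR⟩ : ∃ R : ℝ, 0 < R ∧ R ≤ R₀ ∧ 16 * R ^ 2 * C ^ 2 ≤ 1 := by
    refine ⟨min R₀ (1 / (4 * (|C| + 1))), by positivity, min_le_left _ _, ?_⟩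
    have h1 : min R₀ (1 / (4 * (|C| + 1))) ≤ 1 / (4 * (|C| + 1)) := min_le_right _ _
    have h0 : 0 < min R₀ (1 / (4 * (|C| + 1))) := by positivity
    generalize min R₀ (1 / (4 * (|C| + 1))) = r at h1 h0
    rw [le_div_iff₀ (by positivity)] at h1
    have h2 : 4 * r * |C| ≤ 1 := by nlinarith [abs_nonneg C]
    have h3 : (4 * r * |C|) ^ 2 ≤ 1 := by
      have : 0 ≤ 4 * r * |C| := by positivity
      nlinarith
    calc _ = (4 * r * |C|) ^ 2 := by rw [mul_pow, sq_abs]; ring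
      _ ≤ 1 := h3
  let χ : ContDiffBump (0 : ℂ) := ⟨R / 2, R, by positivity, by linarith⟩
  set X : ℂ → ℂ := fun z => (χ z : ℂ) with hXdef
  have hX : ContDiff ℝ (⊤ : ℕ∞) X := Complex.ofRealCLM.contDiff.comp χ.contDiff
  have hXR : ∀ z, X z ≠ 0 → ‖z‖ ≤ R := by
    intro z hz
    by_contra h
    exact hz (by simp only [hXdef]; rw [χ.zero_of_le_dist (by simpa using (not_le.1 h).le)]; simp)
  have hX1 : ∀ z, ‖z‖ < R / 2 → dbar X z = 0 := by
    intro z hz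
    have h1 : X =ᶠ[nhds z] fun _ => 1 := by
      have : (χ : ℂ → ℝ) =ᶠ[nhds z] 1 := χ.eventuallyEq_one_of_mem_ball (by simpa using hz)
      filter_upwards [this] with y hy
      simp [hXdef, hy]
    have h2 : ∀ v, dirDeriv v X z = 0 := fun v => by
      simp only [dirDeriv, h1.fderiv_eq]; simp
    simp [dbar, h2]
  set K := ∫ z, ‖dbar X z * w z‖ ^ 2
  have hwc := hw.1.continuous
  have i2 : IntegrableOn (fun z => ‖w z‖ ^ 2) (ball 0 (R / 4)) :=
    ((by fun_prop : Continuous fun z => ‖w z‖ ^ 2).continuousOn.integrableOn_compact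
      (isCompact_closedBall (0 : ℂ) (R / 4))).mono_set ball_subset_closedBall
  have hmain : ∀ n : ℕ, ∫ z in ball 0 (R / 4), ‖w z‖ ^ 2 ≤ 16 * R ^ 2 * K * (1 / 4) ^ n := by
    intro n
    have h1 := hw.integral_div_pow_le hR hCR (fun z hz => hC z (hz.trans hRR)) hX hXR hX1 n
    have hv : Continuous fun z => w z / z ^ n := (hw.differentiable_div_pow n).continuous
    have hXc := hX.continuous
    have i3 : Integrable fun z => ‖X z * (w z / z ^ n)‖ ^ 2 := by
      have k1 : Continuous fun z => ‖X z * (w z / z ^ n)‖ ^ 2 := by fun_prop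
      refine k1.integrable_of_hasCompactSupport
        (HasCompactSupport.of_support_subset_isCompact (isCompact_closedBall (0 : ℂ) R) ?_)
      intro z hz
      simpa using hXR z (fun h => hz (by simp [h]))
    have h2 : ∫ z in ball 0 (R / 4), (4 / R) ^ (2 * n) * ‖w z‖ ^ 2 ≤
        ∫ z in ball 0 (R / 4), ‖X z * (w z / z ^ n)‖ ^ 2 := by
      refine setIntegral_mono_on (i2.const_mul _) i3.integrableOn measurableSet_ball fun z hz => ?_
      have hz' : ‖z‖ < R / 4 := by simpa using hz
      have hχ : X z = 1 := by
        simp only [hXdef]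
        rw [χ.one_of_mem_closedBall (by
          simp only [mem_closedBall, dist_zero_right]
          change ‖z‖ ≤ R / 2
          linarith)]
        simp
      rw [hχ, one_mul, norm_div, norm_pow]
      by_cases h0 : z = 0
      · rw [h0, (hw.2 1).1]; simp
      have h0' : 0 < ‖z‖ := by simpa using h0
      rw [pow_mul', ← mul_pow]
      have h3 : 4 / R ≤ 1 / ‖z‖ := by
        rw [div_le_div_iff₀ hR h0']; linarith
      have : (4 / R) ^ n * ‖w z‖ ≤ ‖w z‖ / ‖z‖ ^ n := by
        calc _ ≤ (1 / ‖z‖) ^ n * ‖w z‖ := by gcongr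
          _ = _ := by rw [one_div, inv_pow]; ring
      gcongr
    have h3 : ∫ z in ball 0 (R / 4), ‖X z * (w z / z ^ n)‖ ^ 2 ≤ ∫ z, ‖X z * (w z / z ^ n)‖ ^ 2 :=
      setIntegral_le_integral i3 (Filter.Eventually.of_forall fun z => by positivity)
    rw [integral_const_mul] at h2
    have h4 := (h2.trans h3).trans h1
    have e1 : (4 / R) ^ (2 * n) = (2 / R) ^ (2 * n) * 4 ^ n := by
      rw [show (4 : ℝ) ^ n = 2 ^ (2 * n) by rw [pow_mul]; norm_num, ← mul_pow]
      congr 1; ring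
    have e2 : 0 < (2 / R) ^ (2 * n) := by positivity
    rw [e1, mul_assoc, mul_left_comm (16 * R ^ 2), mul_le_mul_iff_right₀ e2] at h4
    rw [one_div, inv_pow, ← div_eq_mul_inv, le_div_iff₀ (by positivity)]
    linarith
  have hlim : Filter.Tendsto (fun n : ℕ => 16 * R ^ 2 * K * (1 / 4 : ℝ) ^ n) Filter.atTop
      (nhds 0) := by
    simpa using (tendsto_pow_atTop_nhds_zero_of_lt_one (by norm_num : (0 : ℝ) ≤ 1 / 4)
      (by norm_num)).const_mul (16 * R ^ 2 * K)
  have hI : ∫ z in ball 0 (R / 4), ‖w z‖ ^ 2 = 0 :=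
    le_antisymm (ge_of_tendsto' hlim hmain) (integral_nonneg fun z => by positivity)
  rw [setIntegral_eq_zero_iff_of_nonneg_ae (Filter.Eventually.of_forall fun z => by positivity)
    i2] at hI
  have := Measure.eqOn_open_of_ae_eq hI isOpen_ball (by fun_prop) continuousOn_const
  filter_upwards [ball_mem_nhds (0 : ℂ) (by positivity : 0 < R / 4)] with z hz
  simpa using this hz

theorem dirDeriv_ofReal {G : ℂ → ℝ} (hG : ContDiff ℝ (⊤ : ℕ∞) G) (v z : ℂ) :
    dirDeriv v (fun z => (G z : ℂ)) z = (fderiv ℝ G z v : ℝ) := by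
  have h1 := (hG.differentiable (by simp) z).hasFDerivAt
  have h2 := (Complex.ofRealCLM.hasFDerivAt.comp z h1).fderiv
  change fderiv ℝ (⇑Complex.ofRealCLM ∘ G) z v = _
  rw [h2]
  simp

/-- If `w = c z ^ n + o(|z| ^ n)` is the conjugate gradient of `G` with `c ≠ 0`, then `G` increases
strictly along some ray issuing from the origin. -/
theorem exists_ray_lt {G : ℂ → ℝ} (hG : ContDiff ℝ (⊤ : ℕ∞) G) {n : ℕ} {c : ℂ} (hc : c ≠ 0)
    {C : ℝ} (hC : ∀ z : ℂ, ‖z‖ ≤ 1 → ‖((fderiv ℝ G z 1 : ℝ) - Complex.I * (fderiv ℝ G z Complex.I : ℝ) : ℂ)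
      - c * z ^ n‖ ≤ C * ‖z‖ ^ (n + 1)) :
    ∃ e : ℂ, ∃ r > 0, ∀ σ : ℝ, 0 < σ → σ < r → G 0 < G (σ • e) := by
  have hc0 : 0 < ‖c‖ := by simpa using hc
  obtain ⟨e, he⟩ := IsAlgClosed.exists_pow_nat_eq ((‖c‖ : ℂ) / c) (n.succ_pos)
  have he1 : ‖e‖ = 1 := by
    have : ‖e‖ ^ n.succ = 1 := by
      rw [← norm_pow, he]; simp [hc0.ne']
    exact (pow_eq_one_iff_of_nonneg (norm_nonneg _) n.succ_ne_zero).1 this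
  have he2 : c * e ^ (n + 1) = ‖c‖ := by
    rw [he]; field_simp
  set r : ℝ := min 1 (‖c‖ / (|C| + 1)) with hr
  have hr0 : 0 < r := by positivity
  refine ⟨e, r, hr0, fun σ h0 h1 => ?_⟩
  have hd : ∀ x : ℝ, HasDerivAt (fun x : ℝ => G (x • e)) (fderiv ℝ G (x • e) e) x := by
    intro x
    have h1 := (hG.differentiable (by simp) (x • e)).hasFDerivAt
    have h2 : HasDerivAt (fun x : ℝ => x • e) ((1 : ℝ) • e) x := (hasDerivAt_id x).smul_const e
    rw [one_smul] at h2
    exact h1.comp_hasDerivAt x h2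
  have hmono : StrictMonoOn (fun x : ℝ => G (x • e)) (Set.Icc 0 σ) := by
    refine strictMonoOn_of_deriv_pos (convex_Icc _ _)
      (fun x _ => (hd x).continuousAt.continuousWithinAt) fun x hx => ?_
    rw [interior_Icc] at hx
    rw [(hd x).deriv]
    obtain ⟨hx0, hx1⟩ := hx
    have hxr : x < r := hx1.trans h1
    have hx1' : x ≤ 1 := hxr.le.trans (min_le_left _ _)
    have hx2 : x * (|C| + 1) < ‖c‖ := by
      rw [← lt_div_iff₀ (by positivity)]; exact hxr.trans_le (min_le_right _ _)
    have hn : ‖x • e‖ = x := by rw [norm_smul, he1, mul_one, Real.norm_of_nonneg hx0.le]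
    have hb := hC (x • e) (by rw [hn]; exact hx1')
    rw [hn] at hb
    set z := x • e
    set W : ℂ := (fderiv ℝ G z 1 : ℝ) - Complex.I * (fderiv ℝ G z Complex.I : ℝ) with hW
    have e1 : fderiv ℝ G z e = (W * e).re := by
      have : e = e.re • (1 : ℂ) + e.im • Complex.I := by simp
      conv_lhs => rw [this]
      rw [map_add, map_smul, map_smul]
      simp [hW, Complex.mul_re, Complex.mul_im]
      ring
    have e2 : W * e = (x ^ n * ‖c‖ : ℝ) + (W - c * z ^ n) * e := by
      have : c * z ^ n * e = (x ^ n * ‖c‖ : ℝ) := by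
        push_cast
        rw [← he2]
        simp only [z, Complex.real_smul]
        ring
      rw [← this]; ring
    have e3 : |((W - c * z ^ n) * e).re| ≤ C * x ^ (n + 1) := by
      refine (Complex.abs_re_le_norm _).trans ?_
      rw [norm_mul, he1, mul_one]; exact hb
    rw [e1, e2, Complex.add_re, Complex.ofReal_re]
    have e4 : C * x ^ (n + 1) < x ^ n * ‖c‖ := by
      have : 0 < x ^ n := by positivity
      calc C * x ^ (n + 1) ≤ x ^ n * (x * (|C| + 1)) := by
            rw [pow_succ]
            have : C ≤ |C| + 1 := (le_abs_self C).trans (by linarith)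
            have : C * (x ^ n * x) ≤ (|C| + 1) * (x ^ n * x) := by gcongr
            linarith
        _ < _ := by gcongr
    linarith [neg_abs_le ((W - c * z ^ n) * e).re]
  have := hmono (Set.left_mem_Icc.2 h0.le) (Set.right_mem_Icc.2 h0.le) h0
  simpa using this

/-- A solution of a linear elliptic equation `ΔG = b₁ ∂₁G + b₂ ∂₂G` near the origin of the plane is
either locally constant or exceeds its value at the origin along some segment. -/
theorem eventually_const_or_exists_ray_lt {G b1 b2 : ℂ → ℝ} (hG : ContDiff ℝ (⊤ : ℕ∞) G)
    (hb1 : ContDiff ℝ (⊤ : ℕ∞) b1) (hb2 : ContDiff ℝ (⊤ : ℕ∞) b2)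
    (hpde : ∀ᶠ z in nhds 0, fderiv ℝ (fun z => fderiv ℝ G z 1) z 1 +
      fderiv ℝ (fun z => fderiv ℝ G z Complex.I) z Complex.I =
        b1 z * fderiv ℝ G z 1 + b2 z * fderiv ℝ G z Complex.I) :
    (∀ᶠ z in nhds 0, G z = G 0) ∨
      ∃ e : ℂ, ∃ r > 0, ∀ σ : ℝ, 0 < σ → σ < r → G 0 < G (σ • e) := by
  have hd : ∀ v, ContDiff ℝ (⊤ : ℕ∞) fun z => fderiv ℝ G z v := fun v =>
    (hG.fderiv_right (m := (⊤ : ℕ∞)) (by simp)).clm_apply contDiff_const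
  have hof : ∀ {h : ℂ → ℝ}, ContDiff ℝ (⊤ : ℕ∞) h → ContDiff ℝ (⊤ : ℕ∞) fun z => (h z : ℂ) :=
    fun h => Complex.ofRealCLM.contDiff.comp h
  set f : ℂ → ℂ := fun z => (G z : ℂ) with hf
  set g : ℂ → ℂ → ℂ := fun v z => (fderiv ℝ G z v : ℝ) with hg
  have hgs : ∀ v, ContDiff ℝ (⊤ : ℕ∞) (g v) := fun v => hof (hd v)
  have hfg : ∀ v, dirDeriv v f = g v := fun v => funext fun z => dirDeriv_ofReal hG v z
  have hgd : ∀ v a z, dirDeriv a (g v) z = (fderiv ℝ (fun z => fderiv ℝ G z v) z a : ℝ) :=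
    fun v a z => dirDeriv_ofReal (hd v) a z
  set w : ℂ → ℂ := fun z => g 1 z + -Complex.I * g Complex.I z with hw
  have hIg : ContDiff ℝ (⊤ : ℕ∞) fun z => -Complex.I * g Complex.I z := contDiff_const.mul (hgs _)
  have hws : ContDiff ℝ (⊤ : ℕ∞) w := (hgs 1).add hIg
  have hwd : ∀ v z, dirDeriv v w z = dirDeriv v (g 1) z + -Complex.I * dirDeriv v (g Complex.I) z := by
    intro v z
    have h1 := dirDeriv_add (hgs 1) hIg v
    have h2 := dirDeriv_mul (f := fun _ => -Complex.I) contDiff_const (hgs Complex.I) v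
    rw [dirDeriv_const, zero_mul, add_zero] at h2
    change dirDeriv v (g 1 + (fun _ => -Complex.I) * g Complex.I) z = _
    rw [show dirDeriv v (g 1 + (fun _ => -Complex.I) * g Complex.I) =
      dirDeriv v (g 1) + dirDeriv v ((fun _ => -Complex.I) * g Complex.I) from h1, h2]
    rfl
  have hE : ∀ᶠ z in nhds 0, dirDeriv Complex.I w z + -Complex.I * dirDeriv 1 w z =
      -Complex.I * (b1 z * g 1 z + b2 z * g Complex.I z) := by
    filter_upwards [hpde] with z hz
    have hc : dirDeriv 1 (g Complex.I) z = dirDeriv Complex.I (g 1) z := by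
      rw [← hfg, ← hfg, dirDeriv_comm (hof hG)]
    have hz' : dirDeriv 1 (g 1) z + dirDeriv Complex.I (g Complex.I) z =
        b1 z * g 1 z + b2 z * g Complex.I z := by
      rw [hgd, hgd]; simp only [hg]; exact_mod_cast hz
    rw [hwd, hwd, hc, ← hz']
    linear_combination dirDeriv Complex.I (g 1) z * Complex.I_mul_I
  by_cases hflat : ∀ n, JetZero n w
  · left
    obtain ⟨C, hC⟩ := (isCompact_closedBall (0 : ℂ) 1).exists_bound_of_continuousOn
      (f := fun z => |b1 z| + |b2 z|)
      ((hb1.continuous.abs.add hb2.continuous.abs).continuousOn)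
    obtain ⟨ρ, hρ, hρE⟩ := Metric.nhds_basis_closedBall.eventually_iff.1 hE
    have hz := FlatAtZero.eventually_eq_zero (w := w) ⟨hws, hflat⟩ (C := C)
      (R₀ := min ρ 1) (by positivity) (by
        intro z hz
        have h1 := hρE (x := z) (by simpa using hz.trans (min_le_left _ _))
        have h2 := hC z (by simpa using hz.trans (min_le_right _ _))
        have h3 : dbar w z = Complex.I * (dirDeriv Complex.I w z + -Complex.I * dirDeriv 1 w z) := by
          simp only [dbar]
          linear_combination dirDeriv 1 w z * Complex.I_mul_I
        have hr : (w z).re = fderiv ℝ G z 1 := by simp [hw, hg]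
        have hi : (w z).im = -fderiv ℝ G z Complex.I := by simp [hw, hg]
        have k1 : ‖g 1 z‖ ≤ ‖w z‖ := by
          have := Complex.abs_re_le_norm (w z)
          rw [hr] at this
          simpa [hg] using this
        have k2 : ‖g Complex.I z‖ ≤ ‖w z‖ := by
          have := Complex.abs_im_le_norm (w z)
          rw [hi, abs_neg] at this
          simpa [hg] using this
        rw [h3, h1]
        simp only [norm_mul, norm_neg, Complex.norm_I, one_mul]
        rw [Real.norm_of_nonneg (by positivity)] at h2
        calc _ ≤ |b1 z| * ‖g 1 z‖ + |b2 z| * ‖g Complex.I z‖ := by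
              refine (norm_add_le _ _).trans (le_of_eq ?_)
              simp
          _ ≤ |b1 z| * ‖w z‖ + |b2 z| * ‖w z‖ := by gcongr
          _ = (|b1 z| + |b2 z|) * ‖w z‖ := by ring
          _ ≤ _ := by gcongr)
    obtain ⟨ρ', hρ', hρ0⟩ := Metric.nhds_basis_ball.eventually_iff.1 hz
    filter_upwards [ball_mem_nhds (0 : ℂ) hρ'] with z hz
    refine isOpen_ball.is_const_of_fderiv_eq_zero (𝕜 := ℝ) (convex_ball (0 : ℂ) ρ').isPreconnected
      (hG.differentiable (by simp)).differentiableOn ?_ hz (mem_ball_self hρ')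
    intro y hy
    have h0 : w y = 0 := hρ0 hy
    have hr := congrArg Complex.re h0
    have hi := congrArg Complex.im h0
    simp [hw, hg] at hr hi
    ext v
    have : v = v.re • (1 : ℂ) + v.im • Complex.I := by simp
    rw [this, map_add, map_smul, map_smul, hr, hi]
    simp
  · right
    obtain ⟨n, hn, hn'⟩ : ∃ n, JetZero n w ∧ ¬ JetZero (n + 1) w := by
      by_contra! h
      exact hflat fun n => Nat.rec trivial (fun n ih => h n ih) n
    have hconj := JetZero.conj hws hn
    have hcs : ContDiff ℝ (⊤ : ℕ∞) fun z => (starRingEnd ℂ) (w z) :=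
      Complex.conjCLE.contDiff.comp hws
    have hjE : JetZero n (fun z => dirDeriv Complex.I w z + -Complex.I * dirDeriv 1 w z) := by
      have c1 : ContDiff ℝ (⊤ : ℕ∞) fun z => -Complex.I * (b1 z / 2) + b2 z / 2 :=
        (contDiff_const.mul ((hof hb1).div_const _)).add ((hof hb2).div_const _)
      have c2 : ContDiff ℝ (⊤ : ℕ∞) fun z => -Complex.I * (b1 z / 2) + -(b2 z / 2 : ℂ) :=
        (contDiff_const.mul ((hof hb1).div_const _)).add ((hof hb2).div_const _).neg
      have h := JetZero.add (c1.mul hws) (c2.mul hcs) (JetZero.mul c1 hws hn)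
        (JetZero.mul c2 hcs hconj)
      refine h.congr (hE.mono fun z hz => ?_)
      refine Eq.trans ?_ hz.symm
      simp only [Pi.add_apply, hw, map_add, map_mul, map_neg, Complex.conj_I, hg,
        Complex.conj_ofReal]
      ring
    obtain ⟨c, hc⟩ := JetZero.exists_leading_coeff hws hn hjE
    have hc0 : c ≠ 0 := by
      rintro rfl
      exact hn' (by simpa using hc)
    have hps : ContDiff ℝ (⊤ : ℕ∞) fun z => w z + -c * z ^ n :=
      hws.add (contDiff_const.mul (contDiff_id.pow n))
    obtain ⟨C, hC⟩ := JetZero.bound hps hc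
    refine exists_ray_lt hG hc0 (n := n) (C := C) fun z hz => ?_
    refine le_of_eq_of_le (congrArg norm ?_) (hC z hz)
    simp only [hw, hg]
    ring

/-- Second derivative test, necessary form. -/
theorem IsLocalMax.hasDerivAt_hasDerivAt_nonpos {φ ψ : ℝ → ℝ} {a c : ℝ} (hmax : IsLocalMax φ a)
    (h1 : ∀ᶠ σ in nhds a, HasDerivAt φ (ψ σ) σ) (h2 : HasDerivAt ψ c a) : ψ a = 0 ∧ c ≤ 0 := by
  have h0 : ψ a = 0 := hmax.hasDerivAt_eq_zero h1.self_of_nhds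
  refine ⟨h0, ?_⟩
  by_contra! hc
  have hd : deriv φ =ᶠ[nhds a] ψ := h1.mono fun σ h => h.deriv
  have hmin : IsLocalMin φ a := by
    refine isLocalMin_of_deriv_deriv_pos ?_ ?_ h1.self_of_nhds.continuousAt
    · rw [hd.deriv_eq, h2.deriv]; exact hc
    · rw [h1.self_of_nhds.deriv, h0]
  have heq : φ =ᶠ[nhds a] fun _ => φ a := by
    filter_upwards [hmax, hmin] with σ s1 s2 using le_antisymm s1 s2
  have hz : ψ =ᶠ[nhds a] fun _ => 0 := by
    refine hd.symm.trans (heq.deriv.trans ?_)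
    filter_upwards with σ
    simp
  have := (h2.congr_of_eventuallyEq hz.symm).unique (hasDerivAt_const a (0 : ℝ))
  exact hc.ne' this

theorem hasDerivAt_sqrt_one_add_sq (z : ℝ) :
    HasDerivAt (fun z => √(1 + z ^ 2)) (z / √(1 + z ^ 2)) z := by
  have h0 : HasDerivAt (fun z : ℝ => z ^ 2) (2 * z) z := by simpa using hasDerivAt_pow 2 z
  have h := (h0.const_add 1).sqrt (by positivity)
  convert h using 1
  field_simp

theorem hasDerivAt_div_sqrt_one_add_sq (z : ℝ) :
    HasDerivAt (fun z => z / √(1 + z ^ 2)) ((√(1 + z ^ 2))⁻¹ ^ 3) z := by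
  have hp : 0 < √(1 + z ^ 2) := by positivity
  have h := (hasDerivAt_id' z).div (hasDerivAt_sqrt_one_add_sq z) hp.ne'
  have h2 : √(1 + z ^ 2) ^ 2 = 1 + z ^ 2 := Real.sq_sqrt (by positivity)
  have e : (√(1 + z ^ 2))⁻¹ ^ 3 =
      (1 * √(1 + z ^ 2) - z * (z / √(1 + z ^ 2))) / √(1 + z ^ 2) ^ 2 := by
    field_simp
    linarith
  rw [e]
  exact h

/-- First and second order conditions along a line for the barrier function
`y + ε x ^ 2 - δ √(1 + z ^ 2)`. -/
theorem barrier_conditions_of_isLocalMax {s c ε δ x τ d1 d2 U2 : ℝ} {U U1 : ℝ → ℝ}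
    (hU : ∀ᶠ σ in nhds 0, HasDerivAt U (U1 σ) σ) (hU1 : HasDerivAt U1 U2 0)
    (hmax : IsLocalMax (fun σ => (-s * (τ + σ * d2) + c * U σ) + ε * (x + σ * d1) ^ 2
      - δ * √(1 + (c * (τ + σ * d2) + s * U σ) ^ 2)) 0) :
    (-s * d2 + c * U1 0) + 2 * ε * x * d1 - δ * ((c * τ + s * U 0) /
      √(1 + (c * τ + s * U 0) ^ 2)) * (c * d2 + s * U1 0) = 0 ∧
    c * U2 + 2 * ε * d1 ^ 2 - δ * ((√(1 + (c * τ + s * U 0) ^ 2))⁻¹ ^ 3 * (c * d2 + s * U1 0) ^ 2 +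
      (c * τ + s * U 0) / √(1 + (c * τ + s * U 0) ^ 2) * (s * U2)) ≤ 0 := by
  have hl : ∀ (a d σ : ℝ), HasDerivAt (fun σ => a + σ * d) d σ := fun a d σ => by
    simpa using ((hasDerivAt_id σ).mul_const d).const_add a
  have hZ : ∀ σ, HasDerivAt U (U1 σ) σ →
      HasDerivAt (fun σ => c * (τ + σ * d2) + s * U σ) (c * d2 + s * U1 σ) σ := fun σ h =>
    ((hl τ d2 σ).const_mul c).add (h.const_mul s)
  have h1 : ∀ᶠ σ in nhds 0, HasDerivAt (fun σ => (-s * (τ + σ * d2) + c * U σ)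
      + ε * (x + σ * d1) ^ 2 - δ * √(1 + (c * (τ + σ * d2) + s * U σ) ^ 2))
      ((-s * d2 + c * U1 σ) + ε * (2 * (x + σ * d1) * d1) -
        δ * ((c * (τ + σ * d2) + s * U σ) / √(1 + (c * (τ + σ * d2) + s * U σ) ^ 2) *
          (c * d2 + s * U1 σ))) σ := by
    filter_upwards [hU] with σ h
    have k2 : HasDerivAt (fun σ => (x + σ * d1) ^ 2) (2 * (x + σ * d1) * d1) σ := by
      have h0 : HasDerivAt (fun z : ℝ => z ^ 2) (2 * (x + σ * d1)) (x + σ * d1) := by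
        simpa using hasDerivAt_pow 2 (x + σ * d1)
      exact h0.comp σ (hl x d1 σ)
    exact ((((hl τ d2 σ).const_mul (-s)).add (h.const_mul c)).add (k2.const_mul ε)).sub
      (((hasDerivAt_sqrt_one_add_sq _).comp σ (hZ σ h)).const_mul δ)
  have h2 : HasDerivAt (fun σ => (-s * d2 + c * U1 σ) + ε * (2 * (x + σ * d1) * d1) -
        δ * ((c * (τ + σ * d2) + s * U σ) / √(1 + (c * (τ + σ * d2) + s * U σ) ^ 2) *
          (c * d2 + s * U1 σ)))
      (c * U2 + ε * (2 * d1 * d1) -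
        δ * ((√(1 + (c * (τ + 0 * d2) + s * U 0) ^ 2))⁻¹ ^ 3 * (c * d2 + s * U1 0) *
          (c * d2 + s * U1 0) +
          (c * (τ + 0 * d2) + s * U 0) / √(1 + (c * (τ + 0 * d2) + s * U 0) ^ 2) * (s * U2))) 0 := by
    have k := ((hasDerivAt_div_sqrt_one_add_sq _).comp 0 (hZ 0 hU.self_of_nhds)).mul
      ((hU1.const_mul s).const_add (c * d2))
    exact (((hU1.const_mul c).const_add (-s * d2)).add
      ((((hl x d1 0).const_mul 2).mul_const d1).const_mul ε)).sub (k.const_mul δ)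
  obtain ⟨r1, r2⟩ := hmax.hasDerivAt_hasDerivAt_nonpos h1 h2
  simp only [zero_mul, add_zero] at r1 r2
  constructor <;> linarith

/-- The pointwise computation behind the maximum principle for `y + ε x ^ 2 - δ √(1 + z ^ 2)`:
`p, q, A, B, C` stand for `u_s, u_t, u_ss, u_st, u_tt`. -/
theorem barrier_algebra {s c ε δ x p q A B C h κ : ℝ} (hsc : s ^ 2 + c ^ 2 = 1)
    (hδ : 0 ≤ δ) (hδε : 4 * δ < 2 * ε) (hεx : (2 * ε * x) ^ 2 ≤ 1)
    (hκ : |κ| ≤ δ) (hh1 : h ≤ 1)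
    (hpde : (1 + q ^ 2) * A - 2 * p * q * B + (1 + p ^ 2) * C =
      (1 + p ^ 2 + q ^ 2) * (s - q * c))
    (f1 : c * p + 2 * ε * x - κ * (s * p) = 0)
    (f2 : -s + c * q - κ * (c + s * q) = 0)
    (s1 : c * A + 2 * ε - δ * (h * (s * p) ^ 2) - κ * (s * A) ≤ 0)
    (s2 : c * C - δ * (h * (c + s * q) ^ 2) - κ * (s * C) ≤ 0)
    (s3 : c * (q ^ 2 * A - 2 * p * q * B + p ^ 2 * C) + 2 * ε * q ^ 2 - δ * (h * (c * p) ^ 2) -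
      κ * (s * (q ^ 2 * A - 2 * p * q * B + p ^ 2 * C)) ≤ 0) : False := by
  obtain ⟨D, hD⟩ : ∃ D, D = c - κ * s := ⟨_, rfl⟩
  have g1 : D * p = -(2 * ε * x) := by rw [hD]; linarith
  have g2 : D * q = s + κ * c := by rw [hD]; linarith
  have hDq : D ^ 2 * (1 + q ^ 2) = 1 + κ ^ 2 := by
    have : D ^ 2 * (1 + q ^ 2) = D ^ 2 + (D * q) ^ 2 := by ring
    rw [this, g2, hD]
    linear_combination (1 + κ ^ 2) * hsc
  have hDp : D ^ 2 * p ^ 2 ≤ 1 := by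
    rw [← mul_pow, g1, neg_sq]; exact hεx
  have hD0 : 0 < D ^ 2 := by
    rcases (sq_nonneg D).lt_or_eq with h | h
    · exact h
    · rw [← h, zero_mul] at hDq; linarith [sq_nonneg κ]
  have hpq : p ^ 2 ≤ 1 + q ^ 2 := by
    refine le_of_mul_le_mul_left ?_ hD0
    rw [hDq]
    linarith [sq_nonneg κ]
  have hR : D * ((1 + p ^ 2 + q ^ 2) * (s - q * c)) = -κ * (1 + p ^ 2 + q ^ 2) := by
    have : D * ((1 + p ^ 2 + q ^ 2) * (s - q * c)) = (1 + p ^ 2 + q ^ 2) * (D * s - c * (D * q)) := by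
      ring
    rw [this, g2, hD]
    linear_combination (-(1 + p ^ 2 + q ^ 2) * κ) * hsc
  have hQ : p ^ 2 + (c + s * q) ^ 2 ≤ 1 + p ^ 2 + q ^ 2 := by
    have : 1 + p ^ 2 + q ^ 2 - (p ^ 2 + (c + s * q) ^ 2) = (c * q - s) ^ 2 := by
      linear_combination (-(1 + q ^ 2)) * hsc
    linarith [sq_nonneg (c * q - s)]
  have hsum : D * ((1 + p ^ 2 + q ^ 2) * (s - q * c)) + 2 * ε * (1 + q ^ 2) -
      δ * h * (p ^ 2 + (c + s * q) ^ 2) ≤ 0 := by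
    rw [← hpde, hD]
    have : δ * h * (p ^ 2 + (c + s * q) ^ 2) =
      δ * (h * (s * p) ^ 2) + δ * (h * (c + s * q) ^ 2) + δ * (h * (c * p) ^ 2) := by
      linear_combination (-δ * h * p ^ 2) * hsc
    rw [this]
    linarith
  rw [hR] at hsum
  have hκ' := (abs_le.1 hκ).2
  have t1 : κ * (1 + p ^ 2 + q ^ 2) ≤ δ * (2 * (1 + q ^ 2)) := by
    calc _ ≤ δ * (1 + p ^ 2 + q ^ 2) := by gcongr
      _ ≤ _ := by gcongr; linarith
  have t2 : δ * h * (p ^ 2 + (c + s * q) ^ 2) ≤ δ * (2 * (1 + q ^ 2)) := by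
    calc _ ≤ δ * 1 * (1 + p ^ 2 + q ^ 2) := by gcongr
      _ ≤ _ := by rw [mul_one]; gcongr; linarith
  linarith [mul_pos (sub_pos.2 hδε) (by positivity : 0 < 1 + q ^ 2)]

theorem hasDerivAt_comp_line {f : ℝ × ℝ → ℝ} {ω d : ℝ × ℝ} {σ : ℝ}
    (hf : DifferentiableAt ℝ f (ω + σ • d)) :
    HasDerivAt (fun σ : ℝ => f (ω + σ • d))
      (d.1 * pds f (ω + σ • d) + d.2 * pdt f (ω + σ • d)) σ := by
  have h2 : HasDerivAt (fun σ : ℝ => ω + σ • d) d σ := by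
    simpa using ((hasDerivAt_id σ).smul_const d).const_add ω
  have h := hf.hasFDerivAt.comp_hasDerivAt σ h2
  have e : d = d.1 • ((1, 0) : ℝ × ℝ) + d.2 • ((0, 1) : ℝ × ℝ) := by ext <;> simp
  have : fderiv ℝ f (ω + σ • d) d =
      d.1 * pds f (ω + σ • d) + d.2 * pdt f (ω + σ • d) := by
    conv_lhs => rw [e]
    rw [map_add, map_smul, map_smul]; simp [pds, pdt]
  rwa [this] at h

theorem pds_pdt_comm {u : ℝ × ℝ → ℝ} {ω : ℝ × ℝ} (hu : ContDiffAt ℝ 2 u ω) :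
    pds (fun q => pdt u q) ω = pdt (fun q => pds u q) ω := by
  have h1 : DifferentiableAt ℝ (fderiv ℝ u) ω :=
    (hu.fderiv_right (m := 1) (by norm_num)).differentiableAt (by norm_num)
  have key : ∀ a b : ℝ × ℝ, fderiv ℝ (fun q => fderiv ℝ u q b) ω a =
      fderiv ℝ (fderiv ℝ u) ω a b := by
    intro a b
    rw [fderiv_clm_apply h1 (differentiableAt_const b)]
    simp
  have hs : IsSymmSndFDerivAt ℝ u ω := hu.isSymmSndFDerivAt (by simp)
  simp only [pds, pdt]
  rw [key, key]
  exact hs.eq _ _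

/-- The function `y + ε x ^ 2 - δ √(1 + z ^ 2)` has no interior local maximum on a translating
graph. -/
theorem not_isLocalMax_barrier {s c ε δ : ℝ} {u : ℝ × ℝ → ℝ} {ω : ℝ × ℝ}
    (hu : ContDiffAt ℝ 2 u ω) (hsc : s ^ 2 + c ^ 2 = 1)
    (hδ : 0 ≤ δ) (hδε : 4 * δ < 2 * ε) (hεx : (2 * ε * ω.1) ^ 2 ≤ 1)
    (hpde : (1 + (pdt u ω) ^ 2) * pds (fun q => pds u q) ω
      - 2 * pds u ω * pdt u ω * pdt (fun q => pds u q) ω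
      + (1 + (pds u ω) ^ 2) * pdt (fun q => pdt u q) ω
      = (1 + (pds u ω) ^ 2 + (pdt u ω) ^ 2) * (s - pdt u ω * c)) :
    ¬ IsLocalMax (fun p => (-s * p.2 + c * u p) + ε * p.1 ^ 2
      - δ * √(1 + (c * p.2 + s * u p) ^ 2)) ω := by
  intro hmax
  have hd : ∀ᶠ p in nhds ω, DifferentiableAt ℝ u p := by
    filter_upwards [hu.eventually (by simp)] with p hp using hp.differentiableAt (by norm_num)
  have hf1 := hu.fderiv_right (m := 1) (by norm_num)
  have hs : DifferentiableAt ℝ (pds u) ω :=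
    (hf1.clm_apply contDiffAt_const).differentiableAt (by norm_num)
  have ht : DifferentiableAt ℝ (pdt u) ω :=
    (hf1.clm_apply contDiffAt_const).differentiableAt (by norm_num)
  have key := fun d : ℝ × ℝ => by
    have hcont : ContinuousAt (fun σ : ℝ => ω + σ • d) 0 := by fun_prop
    have hω : ω + (0 : ℝ) • d = ω := by simp
    have hten : Filter.Tendsto (fun σ : ℝ => ω + σ • d) (nhds 0) (nhds ω) := by
      have := hcont.tendsto; rwa [hω] at this
    have k1 : ∀ᶠ σ in nhds (0 : ℝ), HasDerivAt (fun σ : ℝ => u (ω + σ • d))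
        (d.1 * pds u (ω + σ • d) + d.2 * pdt u (ω + σ • d)) σ :=
      (hten.eventually hd).mono fun σ h => hasDerivAt_comp_line h
    have k2 : HasDerivAt (fun σ : ℝ => d.1 * pds u (ω + σ • d) + d.2 * pdt u (ω + σ • d)) _ 0 :=
      ((hasDerivAt_comp_line (by rwa [hω])).const_mul d.1).add
        ((hasDerivAt_comp_line (by rwa [hω])).const_mul d.2)
    have k3 : IsLocalMax (fun σ : ℝ => (-s * (ω.2 + σ * d.2) + c * u (ω + σ • d))
        + ε * (ω.1 + σ * d.1) ^ 2 - δ * √(1 + (c * (ω.2 + σ * d.2) + s * u (ω + σ • d)) ^ 2)) 0 := by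
      have := hten.eventually hmax
      filter_upwards [this] with σ h
      simpa using h
    have k := barrier_conditions_of_isLocalMax k1 k2 k3
    simp only [zero_smul, add_zero] at k
    exact k
  obtain ⟨a1, a2⟩ := key (1, 0)
  obtain ⟨b1, b2⟩ := key (0, 1)
  obtain ⟨-, c2⟩ := key (pdt u ω, -pds u ω)
  have hsym : pds (pdt u) ω = pdt (pds u) ω := pds_pdt_comm hu
  simp only [hsym] at a2 b2 c2
  set z := c * ω.2 + s * u ω
  have hh : 1 ≤ √(1 + z ^ 2) := by
    rw [Real.one_le_sqrt]; nlinarith [sq_nonneg z]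
  refine barrier_algebra (h := (√(1 + z ^ 2))⁻¹ ^ 3) (κ := δ * (z / √(1 + z ^ 2))) hsc hδ hδε hεx
    ?_ (pow_le_one₀ (by positivity) (inv_le_one_of_one_le₀ hh)) hpde
    ?_ ?_ ?_ ?_ ?_
  · rw [abs_mul, abs_of_nonneg hδ, abs_div, abs_of_nonneg (Real.sqrt_nonneg _)]
    refine mul_le_of_le_one_right hδ (div_le_one_of_le₀ ?_ (by positivity))
    refine Real.le_sqrt_of_sq_le ?_
    rw [sq_abs]; linarith
  · linear_combination a1
  · linear_combination b1
  · linear_combination a2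
  · linear_combination b2
  · linear_combination c2

theorem isClosed_connectedComponentIn {X : Type*} [TopologicalSpace X] {A : Set X}
    (hA : IsClosed A) (x : X) : IsClosed (connectedComponentIn A x) := by
  by_cases hx : x ∈ A
  · refine isClosed_of_closure_subset ?_
    refine isPreconnected_connectedComponentIn.closure.subset_connectedComponentIn
      (subset_closure (mem_connectedComponentIn hx)) ?_
    exact closure_minimal (connectedComponentIn_subset A x) hA
  · rw [connectedComponentIn_eq_empty hx]
    exact isClosed_empty

theorem graphPtθ_apply_zero (θ : ℝ) (u : ℝ × ℝ → ℝ) (p : ℝ × ℝ) : graphPtθ θ u p 0 = p.1 := by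
  simp [graphPtθ, e1, e2, e3, vθ, bθ]

theorem graphPtθ_apply_one (θ : ℝ) (u : ℝ × ℝ → ℝ) (p : ℝ × ℝ) :
    graphPtθ θ u p 1 = -sin θ * p.2 + cos θ * u p := by
  simp [graphPtθ, e1, e2, e3, vθ, bθ]
  ring

theorem graphPtθ_apply_two (θ : ℝ) (u : ℝ × ℝ → ℝ) (p : ℝ × ℝ) :
    graphPtθ θ u p 2 = cos θ * p.2 + sin θ * u p := by
  simp [graphPtθ, e1, e2, e3, vθ, bθ]
  ring

theorem continuousOn_graphPtθ (θ : ℝ) {u : ℝ × ℝ → ℝ} {K : Set (ℝ × ℝ)} (hu : ContinuousOn u K) :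
    ContinuousOn (graphPtθ θ u) K := by
  unfold graphPtθ
  fun_prop

theorem inner_e3_vθ (θ : ℝ) : ⟪e3, vθ θ⟫ = sin θ := by
  simp [e3, e2, vθ, inner_add_right, inner_smul_right, EuclideanSpace.inner_single_left]

theorem inner_e3_e1 : ⟪e3, e1⟫ = 0 := by
  simp [e3, e1, EuclideanSpace.inner_single_left]

theorem inner_e3_bθ (θ : ℝ) : ⟪e3, bθ θ⟫ = cos θ := by
  simp [e3, e2, bθ, inner_sub_right, inner_smul_right, EuclideanSpace.inner_single_left]

theorem graphPtθ_mem_connectedComponentIn {θ t : ℝ} {u : ℝ × ℝ → ℝ} {Ω K : Set (ℝ × ℝ)}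
    {S : Set E3} {p : E3} (hu : ContinuousOn u Ω) (hS : ∀ ω ∈ Ω, graphPtθ θ u ω ∈ S)
    (hK : IsPreconnected K) (hKΩ : K ⊆ Ω) (ht : ∀ ω ∈ K, t ≤ graphPtθ θ u ω 1) {ω : ℝ × ℝ}
    (hω : ω ∈ K) (hωp : graphPtθ θ u ω ∈ connectedComponentIn (S ∩ {q : E3 | t ≤ q 1}) p)
    {ω' : ℝ × ℝ} (hω' : ω' ∈ K) :
    graphPtθ θ u ω' ∈ connectedComponentIn (S ∩ {q : E3 | t ≤ q 1}) p := by
  rw [connectedComponentIn_eq hωp]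
  refine (hK.image _ (continuousOn_graphPtθ θ (hu.mono hKΩ))).subset_connectedComponentIn
    (Set.mem_image_of_mem _ hω) ?_ (Set.mem_image_of_mem _ hω')
  rintro _ ⟨z, hz, rfl⟩
  exact ⟨hS z (hKΩ hz), ht z hz⟩

theorem sin_sq_sub_pde {θ : ℝ} {Ω : Set (ℝ × ℝ)} {u : ℝ × ℝ → ℝ} {S : Set E3}
    (hgraph : IsTranslatingGraph e1 (bθ θ) (vθ θ) Ω u S) {p : ℝ × ℝ} (hp : p ∈ Ω) :
    (1 + (pdt u p) ^ 2) * pds (fun q => pds u q) p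
      - 2 * pds u p * pdt u p * pdt (fun q => pds u q) p
      + (1 + (pds u p) ^ 2) * pdt (fun q => pdt u q) p
      = (1 + (pds u p) ^ 2 + (pdt u p) ^ 2) * (sin θ - pdt u p * cos θ) := by
  have h := hgraph.pde p hp
  rwa [inner_e3_vθ, inner_e3_e1, inner_e3_bθ, mul_zero, sub_zero] at h

/-- If a component of `Σ ∩ {y ≥ t}` is bounded in the `y`-direction, it lies in `{y = t}`. -/
theorem component_le_of_bounded {θ t w M : ℝ} {Ω : Set (ℝ × ℝ)} {u : ℝ × ℝ → ℝ} {S : Set E3}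
    (hgraph : IsTranslatingGraph e1 (bθ θ) (vθ θ) Ω u S) (hcomplete : IsClosed S)
    (hw : 0 < w) (hslab : S ⊆ {q : E3 | |q 0| ≤ w}) {p : E3}
    (hM : ∀ q ∈ connectedComponentIn (S ∩ {q : E3 | t ≤ q 1}) p, q 1 < M) :
    ∀ q ∈ connectedComponentIn (S ∩ {q : E3 | t ≤ q 1}) p, q 1 ≤ t := by
  set A : Set E3 := S ∩ {q : E3 | t ≤ q 1} with hA
  set W := connectedComponentIn A p with hW
  have hWA : W ⊆ A := connectedComponentIn_subset A p
  have hAc : IsClosed A := hcomplete.inter (isClosed_le continuous_const (by fun_prop))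
  have hWc : IsClosed W := isClosed_connectedComponentIn hAc p
  have hmemS : ∀ ω ∈ Ω, graphPtθ θ u ω ∈ S := fun ω hω => by
    rw [hgraph.graph_eq]; exact ⟨ω, hω, rfl⟩
  have hW0 : ∀ q ∈ W, q 0 ^ 2 ≤ w ^ 2 := fun q hq => sq_le_sq' (abs_le.1 (hslab (hWA hq).1)).1
    (abs_le.1 (hslab (hWA hq).1)).2
  have key : ∀ ε : ℝ, 0 < ε → 2 * ε * w ≤ 1 → ∀ r ∈ W,
      r 1 ≤ t + ε * w ^ 2 + ε / 4 * √(1 + r 2 ^ 2) := by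
    intro ε hε hεw r hr
    set F : E3 → ℝ := fun q => q 1 + ε * q 0 ^ 2 - ε / 4 * √(1 + q 2 ^ 2) with hF
    have hFc : Continuous F := by
      simp only [hF]; fun_prop
    have hK : IsCompact {q ∈ W | F r ≤ F q} := by
      refine Metric.isCompact_of_isClosed_isBounded
        (hWc.inter (isClosed_le continuous_const hFc)) ?_
      set B := (M + ε * w ^ 2 - F r) / (ε / 4) with hB
      refine (Metric.isBounded_closedBall (x := (0 : E3))
        (r := √(w ^ 2 + (|t| + |M|) ^ 2 + B ^ 2))).subset ?_
      rintro q ⟨hq, hq'⟩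
      have h1 : q 1 ^ 2 ≤ (|t| + |M|) ^ 2 := by
        have l1 : t ≤ q 1 := (hWA hq).2
        refine sq_le_sq' ?_ ?_
        · linarith [neg_abs_le t, abs_nonneg M]
        · linarith [hM q hq, le_abs_self M, abs_nonneg t]
      have h2 : q 2 ^ 2 ≤ B ^ 2 := by
        have l1 : √(1 + q 2 ^ 2) ≤ B := by
          rw [hB, le_div_iff₀ (by positivity)]
          have : ε * q 0 ^ 2 ≤ ε * w ^ 2 := mul_le_mul_of_nonneg_left (hW0 q hq) hε.le
          have := hM q hq
          simp only [hF] at hq' ⊢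
          linarith
        have l2 : |q 2| ≤ √(1 + q 2 ^ 2) := by
          refine Real.le_sqrt_of_sq_le ?_
          rw [sq_abs]; linarith
        rw [← sq_abs]
        exact pow_le_pow_left₀ (abs_nonneg _) (l2.trans l1) 2
      rw [mem_closedBall_zero_iff, EuclideanSpace.norm_eq]
      refine Real.sqrt_le_sqrt ?_
      simp only [Fin.sum_univ_three, Real.norm_eq_abs, sq_abs]
      linarith [hW0 q hq]
    obtain ⟨q, ⟨hqW, hqr⟩, hmax⟩ := hK.exists_isMaxOn ⟨r, hr, le_refl _⟩ hFc.continuousOn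
    have hmax' : ∀ q' ∈ W, F q' ≤ F q := fun q' hq' => by
      by_cases h : F r ≤ F q'
      · exact hmax ⟨hq', h⟩
      · exact (not_le.1 h).le.trans hqr
    have hqt : q 1 ≤ t := by
      by_contra! hlt
      have hqS := (hWA hqW).1
      rw [hgraph.graph_eq] at hqS
      obtain ⟨ω, hω, hqω⟩ := hqS
      replace hqω : q = graphPtθ θ u ω := hqω
      subst hqω
      have huc := hgraph.smooth.continuousOn
      have hsm : ContDiffAt ℝ (⊤ : ℕ∞) u ω :=
        hgraph.smooth.contDiffAt (hgraph.isOpen_dom.mem_nhds hω)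
      have hε0 : |2 * ε * ω.1| ≤ 1 := by
        have := hslab (hWA hqW).1
        simp only [Set.mem_ofPred_eq, graphPtθ_apply_zero] at this
        rw [abs_mul, abs_of_pos (by positivity : 0 < 2 * ε)]
        refine le_trans ?_ hεw
        gcongr
      refine not_isLocalMax_barrier (s := sin θ) (c := cos θ) (ε := ε) (δ := ε / 4)
        (hsm.of_le (WithTop.coe_le_coe.2 (le_top : (2 : ℕ∞) ≤ ⊤))) (sin_sq_add_cos_sq θ)
        (by positivity) (by linarith) ?_ (sin_sq_sub_pde hgraph hω) ?_
      · rw [← sq_abs]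
        exact pow_le_one₀ (abs_nonneg _) hε0
      · have hy : ∀ᶠ z in nhds ω, z ∈ Ω ∧ t < graphPtθ θ u z 1 := by
          refine Filter.Eventually.and (hgraph.isOpen_dom.mem_nhds hω) ?_
          have hc : ContinuousAt (fun z => graphPtθ θ u z 1) ω := by
            have h := (continuousOn_graphPtθ θ huc).continuousAt (hgraph.isOpen_dom.mem_nhds hω)
            exact (by fun_prop : Continuous fun q : E3 => q 1).continuousAt.comp h
          exact hc.eventually (lt_mem_nhds hlt)
        obtain ⟨ρ, hρ, hball⟩ := Metric.nhds_basis_ball.eventually_iff.1 hy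
        filter_upwards [ball_mem_nhds ω hρ] with z hz
        have hzW : graphPtθ θ u z ∈ W :=
          graphPtθ_mem_connectedComponentIn huc hmemS (convex_ball ω ρ).isPreconnected
            (fun x hx => (hball hx).1) (fun x hx => (hball hx).2.le) (mem_ball_self hρ) hqW hz
        have := hmax' _ hzW
        simpa only [hF, graphPtθ_apply_zero, graphPtθ_apply_one, graphPtθ_apply_two] using this
    have h1 := hmax' r hr
    have h2 : ε * q 0 ^ 2 ≤ ε * w ^ 2 := mul_le_mul_of_nonneg_left (hW0 q hqW) hε.le
    have h3 : 0 ≤ ε / 4 * √(1 + q 2 ^ 2) := by positivity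
    have h4 : 0 ≤ ε * r 0 ^ 2 := by positivity
    simp only [hF] at h1
    linarith
  intro r hr
  refine le_of_forall_pos_le_add fun η hη => ?_
  set L := w ^ 2 + √(1 + r 2 ^ 2) / 4 with hL
  have hLp : 0 < L := by positivity
  set ε := min (1 / (2 * w)) (η / L)
  have hε : 0 < ε := by positivity
  have h1 : 2 * ε * w ≤ 1 := by
    have := min_le_left (1 / (2 * w)) (η / L)
    rw [le_div_iff₀ (by positivity)] at this
    linarith
  have h2 : ε * L ≤ η := by
    rw [← le_div_iff₀ hLp]; exact min_le_right _ _
  have := key ε hε h1 r hr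
  rw [hL] at h2
  linarith

/-- A function smooth on a neighbourhood of a point agrees near that point with a globally smooth
function. -/
theorem exists_contDiff_eventuallyEq {E : Type*} [NormedAddCommGroup E] [NormedSpace ℝ E]
    [FiniteDimensional ℝ E] {u : E → ℝ} {Ω : Set E} (hΩ : IsOpen Ω)
    (hu : ContDiffOn ℝ (⊤ : ℕ∞) u Ω) {ω : E} (hω : ω ∈ Ω) :
    ∃ v : E → ℝ, ContDiff ℝ (⊤ : ℕ∞) v ∧ v =ᶠ[nhds ω] u := by
  obtain ⟨ρ, hρ, hρΩ⟩ := Metric.isOpen_iff.1 hΩ ω hω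
  let χ : ContDiffBump ω := ⟨ρ / 4, ρ / 2, by positivity, by linarith⟩
  refine ⟨fun x => χ x * u x, ?_, ?_⟩
  · rw [contDiff_iff_contDiffAt]
    intro x
    by_cases hx : x ∈ Ω
    · exact χ.contDiffAt.mul (hu.contDiffAt (hΩ.mem_nhds hx))
    · have hx' : ρ / 2 < dist x ω := by
        by_contra! h
        exact hx (hρΩ (mem_ball.2 (by linarith)))
      have : (fun x => χ x * u x) =ᶠ[nhds x] fun _ => 0 := by
        filter_upwards [(continuous_id.dist continuous_const).continuousAt.eventually
          (lt_mem_nhds hx')] with y hy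
        rw [χ.zero_of_le_dist (x := y) (le_of_lt hy), zero_mul]
      exact contDiffAt_const.congr_of_eventuallyEq this
  · filter_upwards [χ.eventuallyEq_one] with x hx
    simp [hx]

theorem pds_congr {u v : ℝ × ℝ → ℝ} {ω : ℝ × ℝ} (h : u =ᶠ[nhds ω] v) :
    pds u =ᶠ[nhds ω] pds v :=
  (h.fderiv (𝕜 := ℝ)).mono fun z hz => by simp only [pds, hz]

theorem pdt_congr {u v : ℝ × ℝ → ℝ} {ω : ℝ × ℝ} (h : u =ᶠ[nhds ω] v) :
    pdt u =ᶠ[nhds ω] pdt v :=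
  (h.fderiv (𝕜 := ℝ)).mono fun z hz => by simp only [pdt, hz]

theorem ContDiff.pds {u : ℝ × ℝ → ℝ} (hu : ContDiff ℝ (⊤ : ℕ∞) u) :
    ContDiff ℝ (⊤ : ℕ∞) (pds u) :=
  (hu.fderiv_right (m := (⊤ : ℕ∞)) (by simp)).clm_apply contDiff_const

theorem ContDiff.pdt {u : ℝ × ℝ → ℝ} (hu : ContDiff ℝ (⊤ : ℕ∞) u) :
    ContDiff ℝ (⊤ : ℕ∞) (pdt u) :=
  (hu.fderiv_right (m := (⊤ : ℕ∞)) (by simp)).clm_apply contDiff_const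

/-- The affine chart `ζ ↦ (s₀ + Re ζ, t₀ + c Im ζ)`. -/
def affineChart (ω : ℝ × ℝ) (c : ℝ) (ζ : ℂ) : ℝ × ℝ := (ω.1 + ζ.re, ω.2 + c * ζ.im)

theorem contDiff_affineChart (ω : ℝ × ℝ) (c : ℝ) : ContDiff ℝ (⊤ : ℕ∞) (affineChart ω c) := by
  have h1 : ContDiff ℝ (⊤ : ℕ∞) Complex.re := Complex.reCLM.contDiff
  have h2 : ContDiff ℝ (⊤ : ℕ∞) Complex.im := Complex.imCLM.contDiff
  exact (contDiff_const.add h1).prodMk (contDiff_const.add (contDiff_const.mul h2))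

theorem fderiv_comp_affineChart {f : ℝ × ℝ → ℝ} (hf : ContDiff ℝ (⊤ : ℕ∞) f) (ω : ℝ × ℝ) (c : ℝ)
    (ζ a : ℂ) : fderiv ℝ (fun ζ => f (affineChart ω c ζ)) ζ a =
      a.re * pds f (affineChart ω c ζ) + c * a.im * pdt f (affineChart ω c ζ) := by
  have h1 := (hf.differentiable (by simp) (affineChart ω c ζ)).hasFDerivAt
  have k1 : HasFDerivAt (fun ζ : ℂ => ω.1 + ζ.re) Complex.reCLM ζ :=
    Complex.reCLM.hasFDerivAt.const_add _
  have k2 : HasFDerivAt (fun ζ : ℂ => ω.2 + c * ζ.im) (c • Complex.imCLM) ζ :=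
    (Complex.imCLM.hasFDerivAt.const_mul c).const_add _
  have h3 := (h1.comp ζ (k1.prodMk k2)).fderiv
  change fderiv ℝ (f ∘ affineChart ω c) ζ a = _
  rw [show fderiv ℝ (f ∘ affineChart ω c) ζ = _ from h3]
  have e : ((a.re, c * a.im) : ℝ × ℝ) = a.re • ((1, 0) : ℝ × ℝ) + (c * a.im) • ((0, 1) : ℝ × ℝ) := by
    ext <;> simp
  change fderiv ℝ f (affineChart ω c ζ) (a.re, c * a.im) = _
  rw [e, map_add, map_smul, map_smul]
  simp [pds, pdt]

/-- Near a parameter value, the height `y = -s t + c u` of a translating graph is either constant or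
increases along some segment. -/
theorem height_const_or_exists_ray_lt {s c : ℝ} (hsc : s ^ 2 + c ^ 2 = 1) {u : ℝ × ℝ → ℝ}
    {Ω : Set (ℝ × ℝ)} (hΩ : IsOpen Ω) (hu : ContDiffOn ℝ (⊤ : ℕ∞) u Ω)
    (hpde : ∀ p ∈ Ω, (1 + (pdt u p) ^ 2) * pds (fun q => pds u q) p
      - 2 * pds u p * pdt u p * pdt (fun q => pds u q) p
      + (1 + (pds u p) ^ 2) * pdt (fun q => pdt u q) p
      = (1 + (pds u p) ^ 2 + (pdt u p) ^ 2) * (s - pdt u p * c)) {ω : ℝ × ℝ} (hω : ω ∈ Ω) :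
    (c ≠ 0 ∧ ∀ᶠ p in nhds ω, -s * p.2 + c * u p = -s * ω.2 + c * u ω) ∨
      ∃ d : ℝ × ℝ, ∃ r > 0, ∀ σ : ℝ, 0 < σ → σ < r →
        -s * ω.2 + c * u ω < -s * (ω + σ • d).2 + c * u (ω + σ • d) := by
  by_cases hc : c = 0
  · right
    subst hc
    refine ⟨(0, -s), 1, one_pos, fun σ h0 _ => ?_⟩
    have : s * s = 1 := by linarith
    simp only [Prod.snd_add, Prod.smul_snd, smul_eq_mul, zero_mul, add_zero]
    nlinarith
  obtain ⟨v, hv, hvu⟩ := exists_contDiff_eventuallyEq hΩ hu hω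
  set L := affineChart ω c with hL
  have hLs : ContDiff ℝ (⊤ : ℕ∞) L := contDiff_affineChart ω c
  have hL0 : L 0 = ω := by simp [hL, affineChart]
  have hLt : Filter.Tendsto L (nhds 0) (nhds ω) := by
    have := hLs.continuous.tendsto 0
    rwa [hL0] at this
  set Y : ℝ × ℝ → ℝ := fun p => -s * p.2 + c * v p with hY
  have hYs : ContDiff ℝ (⊤ : ℕ∞) Y :=
    (contDiff_const.mul contDiff_snd).add (contDiff_const.mul hv)
  have hYds : pds Y = fun p => c * pds v p := by
    funext p
    have h1 := (hv.differentiable (by simp) p).hasFDerivAt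
    have h2 := ((hasFDerivAt_snd (𝕜 := ℝ) (p := p)).const_mul (-s)).add (h1.const_mul c)
    simp only [pds, hY]
    rw [show fderiv ℝ (fun p : ℝ × ℝ => -s * p.2 + c * v p) p = _ from h2.fderiv]
    simp
  have hYdt : pdt Y = fun p => -s + c * pdt v p := by
    funext p
    have h1 := (hv.differentiable (by simp) p).hasFDerivAt
    have h2 := ((hasFDerivAt_snd (𝕜 := ℝ) (p := p)).const_mul (-s)).add (h1.const_mul c)
    simp only [pdt, hY]
    rw [show fderiv ℝ (fun p : ℝ × ℝ => -s * p.2 + c * v p) p = _ from h2.fderiv]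
    simp
  have hpdev : ∀ᶠ p in nhds ω, (1 + (pdt v p) ^ 2) * pds (pds v) p
      - 2 * pds v p * pdt v p * pdt (pds v) p + (1 + (pds v p) ^ 2) * pdt (pdt v) p
      = (1 + (pds v p) ^ 2 + (pdt v p) ^ 2) * (s - pdt v p * c) := by
    filter_upwards [hΩ.mem_nhds hω, pds_congr hvu, pdt_congr hvu, pds_congr (pds_congr hvu),
      pdt_congr (pds_congr hvu), pdt_congr (pdt_congr hvu)] with p h0 h1 h2 h3 h4 h5
    rw [h1, h2, h3, h4, h5]
    exact hpde p h0
  have hGs : ContDiff ℝ (⊤ : ℕ∞) fun ζ => Y (L ζ) := hYs.comp hLs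
  have hG1 : (fun ζ => fderiv ℝ (fun ζ => Y (L ζ)) ζ 1) = fun ζ => c * pds v (L ζ) := by
    funext ζ
    rw [fderiv_comp_affineChart hYs, hYds]
    simp [hL]
  have hG2 : (fun ζ => fderiv ℝ (fun ζ => Y (L ζ)) ζ Complex.I) =
      fun ζ => c * (-s + c * pdt v (L ζ)) := by
    funext ζ
    rw [fderiv_comp_affineChart hYs, hYdt]
    simp [hL]
  have hG11 : ∀ ζ, fderiv ℝ (fun ζ => c * pds v (L ζ)) ζ 1 = c * pds (pds v) (L ζ) := by
    intro ζ
    have hd : DifferentiableAt ℝ (fun ζ => pds v (L ζ)) ζ :=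
      (hv.pds.comp hLs).differentiable (by simp) ζ
    rw [fderiv_const_mul hd]
    simp [fderiv_comp_affineChart hv.pds, hL]
  have hG22 : ∀ ζ, fderiv ℝ (fun ζ => c * (-s + c * pdt v (L ζ))) ζ Complex.I =
      c * (c * (c * pdt (pdt v) (L ζ))) := by
    intro ζ
    have hd : DifferentiableAt ℝ (fun ζ => pdt v (L ζ)) ζ :=
      (hv.pdt.comp hLs).differentiable (by simp) ζ
    rw [fderiv_const_mul ((hd.const_mul c).const_add (-s)), fderiv_const_add,
      fderiv_const_mul hd]
    simp [fderiv_comp_affineChart hv.pdt, hL]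
  set β1 : ℝ × ℝ → ℝ := fun p =>
    2 * c ^ 2 * (pdt v p * pdt (pds v) p) - c ^ 2 * (pds v p * pdt (pdt v) p) with hβ1
  set β2 : ℝ × ℝ → ℝ := fun p =>
    -((s + c * pdt v p) * pds (pds v) p) - (1 + (pds v p) ^ 2 + (pdt v p) ^ 2) * c ^ 2 with hβ2
  have hβ1s : ContDiff ℝ (⊤ : ℕ∞) β1 :=
    (contDiff_const.mul (hv.pdt.mul hv.pds.pdt)).sub
      (contDiff_const.mul (hv.pds.mul hv.pdt.pdt))
  have hβ2s : ContDiff ℝ (⊤ : ℕ∞) β2 :=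
    (((contDiff_const.add (contDiff_const.mul hv.pdt)).mul hv.pds.pds).neg).sub
      (((contDiff_const.add (hv.pds.pow 2)).add (hv.pdt.pow 2)).mul contDiff_const)
  have hmain := eventually_const_or_exists_ray_lt hGs (hβ1s.comp hLs) (hβ2s.comp hLs) (by
    rw [hG1, hG2]
    filter_upwards [hLt.eventually hpdev] with ζ hζ
    rw [hG11, hG22]
    have k1 := congrFun hG1 ζ
    have k2 := congrFun hG2 ζ
    rw [k1, k2]
    simp only [Function.comp, hβ1, hβ2]
    linear_combination c ^ 3 * hζ - c * pds (pds v) (L ζ) * hsc)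
  simp only [hL0] at hmain
  have hYu : Y =ᶠ[nhds ω] fun p => -s * p.2 + c * u p := by
    filter_upwards [hvu] with p hp
    simp only [hY, hp]
  have hYω : Y ω = -s * ω.2 + c * u ω := hYu.self_of_nhds
  rcases hmain with h | ⟨e, r, hr, h⟩
  · left
    refine ⟨hc, ?_⟩
    set N : ℝ × ℝ → ℂ := fun p => ⟨p.1 - ω.1, (p.2 - ω.2) / c⟩ with hN
    have hNc : Continuous N := by
      have : N = fun p => ((p.1 - ω.1 : ℝ) : ℂ) + (((p.2 - ω.2) / c : ℝ) : ℂ) * Complex.I := by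
        funext p; simp only [hN]; exact Complex.mk_eq_add_mul_I _ _
      rw [this]
      fun_prop
    have hN0 : N ω = 0 := by simp only [hN, sub_self, zero_div]; rfl
    have hLN : ∀ p, L (N p) = p := fun p => by
      simp only [hL, affineChart, hN]
      ext
      · simp
      · simp; field_simp; ring
    have hNt : Filter.Tendsto N (nhds ω) (nhds 0) := by
      have := hNc.tendsto ω
      rwa [hN0] at this
    filter_upwards [hNt.eventually h, hYu] with p h1 h2
    rw [hLN, hYω] at h1
    rw [← h2, h1]
  · right
    have hlin : ∀ σ : ℝ, L (σ • e) = ω + σ • ((e.re, c * e.im) : ℝ × ℝ) := fun σ => by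
      simp only [hL, affineChart]
      ext
      · simp
      · simp; ring
    have ht : Filter.Tendsto (fun σ : ℝ => L (σ • e)) (nhds 0) (nhds ω) := by
      have : Continuous fun σ : ℝ => L (σ • e) := hLs.continuous.comp (by fun_prop)
      have := this.tendsto 0
      rwa [zero_smul, hL0] at this
    obtain ⟨ρ, hρ, hball⟩ := Metric.nhds_basis_ball.eventually_iff.1 (ht.eventually hYu)
    refine ⟨(e.re, c * e.im), min r ρ, lt_min hr hρ, fun σ h0 h1 => ?_⟩
    have h2 := h σ h0 (h1.trans_le (min_le_left _ _))
    have h3 := hball (x := σ) (by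
      rw [mem_ball_zero_iff, Real.norm_of_nonneg h0.le]
      exact h1.trans_le (min_le_right _ _))
    rw [h3, hYω, hlin] at h2
    exact h2

/-- A translating graph lying in a slab `{|x| ≤ w}` has no component of `Σ ∩ {y ≥ t}` contained in
`{y = t}`. -/
theorem exists_lt_of_mem_component {θ t w : ℝ} {Ω : Set (ℝ × ℝ)} {u : ℝ × ℝ → ℝ} {S : Set E3}
    (hgraph : IsTranslatingGraph e1 (bθ θ) (vθ θ) Ω u S) (hcomplete : IsClosed S)
    (hslab : S ⊆ {q : E3 | |q 0| ≤ w}) {p : E3} (hp : p ∈ S ∩ {q : E3 | t ≤ q 1}) :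
    ∃ q ∈ connectedComponentIn (S ∩ {q : E3 | t ≤ q 1}) p, t < q 1 := by
  by_contra! hle
  set A : Set E3 := S ∩ {q : E3 | t ≤ q 1} with hA
  set W := connectedComponentIn A p with hW
  have hWA : W ⊆ A := connectedComponentIn_subset A p
  have hAc : IsClosed A := hcomplete.inter (isClosed_le continuous_const (by fun_prop))
  have hWc : IsClosed W := isClosed_connectedComponentIn hAc p
  have hΩ := hgraph.isOpen_dom
  have huc := hgraph.smooth.continuousOn
  have hmemS : ∀ ω ∈ Ω, graphPtθ θ u ω ∈ S := fun ω hω => by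
    rw [hgraph.graph_eq]; exact ⟨ω, hω, rfl⟩
  have hSmem : ∀ q ∈ S, ∃ ω ∈ Ω, q = graphPtθ θ u ω := fun q hq => by
    rw [hgraph.graph_eq] at hq; exact hq
  have heq : ∀ ω, graphPtθ θ u ω ∈ W → graphPtθ θ u ω 1 = t := fun ω hω =>
    le_antisymm (hle _ hω) (hWA hω).2
  have hlocal : ∀ ω ∈ Ω, graphPtθ θ u ω ∈ W →
      cos θ ≠ 0 ∧ ∀ᶠ z in nhds ω, graphPtθ θ u z 1 = t := by
    intro ω hω hωW
    rcases height_const_or_exists_ray_lt (sin_sq_add_cos_sq θ) hΩ hgraph.smooth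
      (fun p hp => sin_sq_sub_pde hgraph hp) hω with ⟨hc, h⟩ | ⟨d, r, hr, h⟩
    · refine ⟨hc, h.mono fun z hz => ?_⟩
      rw [← heq ω hωW, graphPtθ_apply_one, graphPtθ_apply_one, hz]
    · exfalso
      simp only [← graphPtθ_apply_one] at h
      have hcl : Continuous fun σ : ℝ => ω + σ • d := by fun_prop
      have ht : Filter.Tendsto (fun σ : ℝ => ω + σ • d) (nhds 0) (nhds ω) := by
        have := hcl.tendsto 0
        rwa [zero_smul, add_zero] at this
      obtain ⟨ρ, hρ, hball⟩ := Metric.nhds_basis_ball.eventually_iff.1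
        (ht.eventually (hΩ.mem_nhds hω))
      set r' := min r ρ with hr'
      have hr0 : 0 < r' := lt_min hr hρ
      have hK : IsPreconnected ((fun σ : ℝ => ω + σ • d) '' Set.Ico 0 r') :=
        (convex_Ico 0 r').isPreconnected.image _ hcl.continuousOn
      have hωK : ω ∈ (fun σ : ℝ => ω + σ • d) '' Set.Ico 0 r' :=
        ⟨0, ⟨le_rfl, hr0⟩, by simp⟩
      have hmem := graphPtθ_mem_connectedComponentIn (t := t) (p := p) huc hmemS hK ?_ ?_ hωK hωW
        (ω' := ω + (r' / 2) • d) ⟨r' / 2, ⟨by positivity, by linarith⟩, rfl⟩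
      · have h1 := h (r' / 2) (by positivity) (by linarith [min_le_left r ρ])
        have h2 := heq _ hmem
        rw [heq ω hωW, h2] at h1
        exact lt_irrefl _ h1
      · rintro _ ⟨σ, ⟨h0, h1⟩, rfl⟩
        refine hball ?_
        rw [mem_ball_zero_iff, Real.norm_of_nonneg h0]
        exact h1.trans_le (min_le_right _ _)
      · rintro _ ⟨σ, ⟨h0, h1⟩, rfl⟩
        rcases h0.eq_or_lt with rfl | h0
        · simp [heq ω hωW]
        · rw [← heq ω hωW]
          exact (h σ h0 (h1.trans_le (min_le_left _ _))).le
  have hpW : p ∈ W := mem_connectedComponentIn hp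
  obtain ⟨ω₀, hω₀, rfl⟩ := hSmem p hp.1
  have hc := (hlocal ω₀ hω₀ hpW).1
  set V : Set (ℝ × ℝ) := {ω | ω ∈ Ω ∧ graphPtθ θ u ω ∈ W} with hV
  have hVo : IsOpen V := by
    rw [isOpen_iff_mem_nhds]
    rintro ω ⟨hω, hωW⟩
    obtain ⟨ρ, hρ, hball⟩ := Metric.nhds_basis_ball.eventually_iff.1
      (Filter.Eventually.and (hΩ.mem_nhds hω) (hlocal ω hω hωW).2)
    refine Filter.mem_of_superset (ball_mem_nhds ω hρ) fun z hz => ⟨(hball hz).1, ?_⟩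
    exact graphPtθ_mem_connectedComponentIn huc hmemS (convex_ball ω ρ).isPreconnected
      (fun x hx => (hball hx).1) (fun x hx => (hball hx).2.ge) (mem_ball_self hρ) hωW hz
  have hVc : IsOpen (Ω ∩ graphPtθ θ u ⁻¹' Wᶜ) :=
    (continuousOn_graphPtθ θ huc).isOpen_inter_preimage hΩ hWc.isOpen_compl
  have hall : ∀ ω ∈ Ω, graphPtθ θ u ω ∈ W := by
    by_contra! h
    obtain ⟨ω₁, h1, h2⟩ := h
    obtain ⟨x, -, ⟨-, hx⟩, -, hx'⟩ := hgraph.isConnected_dom.isPreconnected _ _ hVo hVc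
      (fun ω hω => by
        by_cases h : graphPtθ θ u ω ∈ W
        · exact Or.inl ⟨hω, h⟩
        · exact Or.inr ⟨hω, h⟩)
      ⟨ω₀, hω₀, hω₀, hpW⟩ ⟨ω₁, h1, h1, h2⟩
    exact hx' hx
  set ℓ : ℝ × ℝ → ℝ := fun z => (t + sin θ * z.2) / cos θ with hℓ
  have hpre : Ω = graphPtθ θ ℓ ⁻¹' S := by
    ext z
    constructor
    · intro hz
      have h := heq z (hall z hz)
      rw [graphPtθ_apply_one] at h
      have : ℓ z = u z := by
        simp only [hℓ]; rw [div_eq_iff hc]; linarith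
      simp only [Set.mem_preimage, graphPtθ, this]
      exact hmemS z hz
    · intro hz
      obtain ⟨z', hz', e⟩ := hSmem _ hz
      have i0 := congrArg (fun q : E3 => q 0) e
      have i1 := congrArg (fun q : E3 => q 1) e
      have i2 := congrArg (fun q : E3 => q 2) e
      simp only [graphPtθ_apply_zero, graphPtθ_apply_one, graphPtθ_apply_two] at i0 i1 i2
      have j : z.2 = z'.2 := by
        linear_combination (-sin θ) * i1 + cos θ * i2 - (z.2 - z'.2) * sin_sq_add_cos_sq θ
      rwa [Prod.ext i0 j]
  have hclosed : IsClosed Ω := by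
    rw [hpre]
    refine hcomplete.preimage ?_
    have : Continuous ℓ := by simp only [hℓ]; fun_prop
    exact continuousOn_univ.1 (continuousOn_graphPtθ θ this.continuousOn)
  have huniv : Ω = Set.univ := IsClopen.eq_univ ⟨hclosed, hΩ⟩ ⟨ω₀, hω₀⟩
  have h := hslab (hmemS (w + 1, 0) (by rw [huniv]; trivial))
  simp only [Set.mem_ofPred_eq, graphPtθ_apply_zero] at h
  linarith [le_abs_self (w + 1)]

/-- every nonempty connected component of `Σ ∩ {y ≥ t}` is unbounded in the
`y`-direction. -/
theorem stmt7 (θ : ℝ) (hθ : θ ∈ Set.Ico 0 π) (Ω : Set (ℝ × ℝ)) (u : ℝ × ℝ → ℝ) (S : Set E3)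
    (hgraph : IsTranslatingGraph e1 (bθ θ) (vθ θ) Ω u S) (hcomplete : IsClosed S)
    (w : ℝ) (hw : 0 < w) (hslab : S ⊆ {q : E3 | |q 0| ≤ w}) :
    ∀ t : ℝ, ∀ p ∈ S ∩ {q : E3 | t ≤ q 1}, ∀ M : ℝ,
      ∃ q ∈ connectedComponentIn (S ∩ {q : E3 | t ≤ q 1}) p, M ≤ q 1 := by
  intro t p hp M
  by_contra! hM
  obtain ⟨q, hq, hlt⟩ := exists_lt_of_mem_component hgraph hcomplete hslab hp
  exact absurd hlt (component_le_of_bounded hgraph hcomplete hw hslab hM q hq).not_gt
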